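/- Let t₀ ∈ [0,T], and let f ∈ F be a convex function with ∂_v²f(x₀) = 0 at some point x₀ ∈ (0,∞)ⁿ and for some direction v ∈ ℝⁿ \ {0}. Then, for any ε > 0 there exists a convex function h ∈ F with ∂_v²h(x₀) = 0 such that ∂_v²(Ah)(x₀,t₀) = 0 and |∂_v²(B(f−h))(x₀,t₀)| ≤ ε. Consequently, if the operator M = A + B is LCP at all points of (0,∞)ⁿ × [0,T], then B is LCP at all points. -/

import Mathlib

open MeasureTheory Set Matrix NNReal

noncomputable section

/-- The open positive orthant `(0,∞)ⁿ` in `ℝⁿ`. -/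
def posOrth (n : ℕ) : Set (Fin n → ℝ) := {x | ∀ i, 0 < x i}

/-- First directional derivative of `f` at `x` in direction `v`. -/
def dir1 {n : ℕ} {F : Type*} [NormedAddCommGroup F] [NormedSpace ℝ F]
    (f : (Fin n → ℝ) → F) (x v : Fin n → ℝ) : F :=
  fderiv ℝ f x v

/-- Mixed second derivative: differentiate `f` in direction `v`, then in direction `w`. -/
def dmix {n : ℕ} {F : Type*} [NormedAddCommGroup F] [NormedSpace ℝ F]
    (f : (Fin n → ℝ) → F) (x v w : Fin n → ℝ) : F :=
  fderiv ℝ (fun y => fderiv ℝ f y v) x w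

/-- Second directional derivative of `f` at `x` in direction `v`. -/
def dir2 {n : ℕ} {F : Type*} [NormedAddCommGroup F] [NormedSpace ℝ F]
    (f : (Fin n → ℝ) → F) (x v : Fin n → ℝ) : F :=
  dmix f x v v

/-- The class `F` of test functions: `C⁴` on the positive orthant, with locally Hölder
continuous fourth derivatives, and with `f` together with its derivatives up to order two
of at most polynomial growth. -/
structure MemTestClass (n : ℕ) (f : (Fin n → ℝ) → ℝ) : Prop where
  smooth : ContDiffOn ℝ 4 f (posOrth n)
  holder4 : ∃ α : ℝ≥0, 0 < α ∧ (α : ℝ) ≤ 1 ∧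
    ∀ x ∈ posOrth n, ∃ s ∈ nhds x, s ⊆ posOrth n ∧
      ∃ C : ℝ≥0, HolderOnWith C α (iteratedFDeriv ℝ 4 f) s
  polyGrowth : ∃ C m : ℝ, ∀ x ∈ posOrth n, ∀ k : ℕ, k ≤ 2 →
    ‖iteratedFDeriv ℝ k f x‖ ≤ C * (1 + ‖x‖ ^ m)

/-- The jump structure `φ(x,t,z)` together with the standing assumptions (A3), (A6), (A7). -/
structure JumpKernel (n : ℕ) (T : ℝ) where
  φ : (Fin n → ℝ) → ℝ → ℝ → (Fin n → ℝ)
  meas : ∀ x ∈ posOrth n, ∀ t ∈ Icc (0:ℝ) T, Measurable (fun z => φ x t z)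
  smooth : ∀ t ∈ Icc (0:ℝ) T, ∀ z ∈ Icc (0:ℝ) 1,
    ContDiffOn ℝ 2 (fun x => φ x t z) (posOrth n)
  holder2 : ∃ α : ℝ≥0, 0 < α ∧ (α : ℝ) ≤ 1 ∧
    ∀ t ∈ Icc (0:ℝ) T, ∀ x ∈ posOrth n, ∃ s ∈ nhds x, s ⊆ posOrth n ∧
      ∃ C : ℝ≥0, ∀ z ∈ Icc (0:ℝ) 1,
        HolderOnWith C α (iteratedFDeriv ℝ 2 (fun y => φ y t z)) s
  bound : ∃ D : ℝ, 0 < D ∧ ∀ x ∈ posOrth n, ∀ t ∈ Icc (0:ℝ) T, ∀ z ∈ Icc (0:ℝ) 1,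
    ∀ i, (φ x t z i) ^ 2 ≤ D * (x i) ^ 2
  lower : ∃ γ₀ : ℝ, -1 < γ₀ ∧ ∀ x ∈ posOrth n, ∀ t ∈ Icc (0:ℝ) T, ∀ z ∈ Icc (0:ℝ) 1,
    ∀ i, γ₀ * x i < φ x t z i

/-- For each fixed `(x,t)`, `φ(x,t,z) ≠ 0` for almost every `z ∈ [0,1]`. -/
def JumpKernel.AENonzero {n : ℕ} {T : ℝ} (K : JumpKernel n T) : Prop :=
  ∀ x ∈ posOrth n, ∀ t ∈ Icc (0:ℝ) T,
    ∀ᵐ z ∂(volume.restrict (Icc (0:ℝ) 1)), K.φ x t z ≠ 0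

/-- The jump intensity `λ` : nonnegative and Hölder continuous on `[0,T]`. -/
def LamOK (T : ℝ) (lam : ℝ → ℝ) : Prop :=
  (∀ t ∈ Icc (0:ℝ) T, 0 ≤ lam t) ∧
  ∃ α C : ℝ≥0, 0 < α ∧ (α : ℝ) ≤ 1 ∧ HolderOnWith C α lam (Icc (0:ℝ) T)

/-- The integro-differential jump operator `B`. -/
def Bop {n : ℕ} {T : ℝ} (lam : ℝ → ℝ) (K : JumpKernel n T)
    (f : (Fin n → ℝ) → ℝ) (x : Fin n → ℝ) (t : ℝ) : ℝ :=
  lam t * ∫ z in Icc (0:ℝ) 1,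
    (f (x + K.φ x t z) - f x - fderiv ℝ f x (K.φ x t z))

/-- The diffusion matrix `β(x,t)` together with the standing assumptions (A1), (A3), (A5). -/
structure DiffKernel (n : ℕ) (T : ℝ) where
  β : (Fin n → ℝ) → ℝ → Matrix (Fin n) (Fin n) ℝ
  smooth : ∀ t ∈ Icc (0:ℝ) T, ∀ i j, ContDiffOn ℝ 2 (fun x => β x t i j) (posOrth n)
  holder2 : ∃ α : ℝ≥0, 0 < α ∧ (α : ℝ) ≤ 1 ∧
    ∀ t ∈ Icc (0:ℝ) T, ∀ i j, ∀ x ∈ posOrth n, ∃ s ∈ nhds x, s ⊆ posOrth n ∧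
      ∃ C : ℝ≥0, HolderOnWith C α (iteratedFDeriv ℝ 2 (fun y => β y t i j)) s
  nonsing : ∀ x ∈ posOrth n, ∀ t ∈ Icc (0:ℝ) T, (β x t).det ≠ 0
  bound : ∃ D : ℝ, 0 < D ∧ ∀ x ∈ posOrth n, ∀ t ∈ Icc (0:ℝ) T,
    ∀ i, ∑ j, (β x t i j) ^ 2 ≤ D * (x i) ^ 2

/-- The second order differential operator `A` with coefficient matrix `a = ββ*/2`. -/
def Aop {n : ℕ} {T : ℝ} (Dk : DiffKernel n T)
    (f : (Fin n → ℝ) → ℝ) (x : Fin n → ℝ) (t : ℝ) : ℝ :=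
  ∑ i, ∑ j, ((Dk.β x t * (Dk.β x t)ᵀ) i j / 2) *
    dmix f x (Pi.single i 1) (Pi.single j 1)

/-- An operator `D` (mapping a test function `f` to a function of `(x,t)`) is locally
convexity preserving (LCP) at `(x,t)` if `∂_v²(Df)(x,t) ≥ 0` for every direction `v ≠ 0`
and every convex `f ∈ F` with `∂_v²f(x) = 0`. -/
def IsLCPAt {n : ℕ} (D : ((Fin n → ℝ) → ℝ) → (Fin n → ℝ) → ℝ → ℝ)
    (x : Fin n → ℝ) (t : ℝ) : Prop :=
  ∀ v : Fin n → ℝ, v ≠ 0 → ∀ f : (Fin n → ℝ) → ℝ,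
    MemTestClass n f → ConvexOn ℝ (posOrth n) f → dir2 f x v = 0 →
    0 ≤ dir2 (fun y => D f y t) x v

/-- The integrand in condition (ohly) of Theorem 5.1. -/
def ohlyIntegrand {n : ℕ} {T : ℝ} (K : JumpKernel n T)
    (f : (Fin n → ℝ) → ℝ) (x v : Fin n → ℝ) (t z : ℝ) : ℝ :=
  dmix f (x + K.φ x t z) v v
    + 2 * dmix f (x + K.φ x t z) v (dir1 (fun y => K.φ y t z) x v)
    + dmix f (x + K.φ x t z) (dir1 (fun y => K.φ y t z) x v)
        (dir1 (fun y => K.φ y t z) x v)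
    + (fderiv ℝ f (x + K.φ x t z) (dir2 (fun y => K.φ y t z) x v)
        - fderiv ℝ f x (dir2 (fun y => K.φ y t z) x v))

section

open Filter Topology

section Calculus

set_option maxSynthPendingDepth 3

variable {E F G : Type*} [NormedAddCommGroup E] [NormedSpace ℝ E]
  [NormedAddCommGroup F] [NormedSpace ℝ F] [NormedAddCommGroup G] [NormedSpace ℝ G]

lemma ContDiffAt.differentiableAt_fderiv {f : E → F} {x : E} (hf : ContDiffAt ℝ 2 f x) :
    DifferentiableAt ℝ (fderiv ℝ f) x :=
  (hf.fderiv_right (m := 1) (by norm_num)).differentiableAt (by norm_num)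

lemma ContDiffAt.eventually_contDiffAt_two {f : E → F} {x : E} (hf : ContDiffAt ℝ 2 f x) :
    ∀ᶠ y in 𝓝 x, ContDiffAt ℝ 2 f y :=
  hf.eventually (by simp)

lemma fderiv_fderiv_apply_const {f : E → F} {x : E}
    (hf : DifferentiableAt ℝ (fderiv ℝ f) x) (a b : E) :
    fderiv ℝ (fun y => fderiv ℝ f y b) x a = fderiv ℝ (fderiv ℝ f) x a b := by
  rw [fderiv_clm_apply hf (differentiableAt_const b)]
  simp

lemma fderiv_fderiv_comp {w : F → G} {Φ : E → F} {x : E} (hw : ContDiffAt ℝ 2 w (Φ x))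
    (hΦ : ContDiffAt ℝ 2 Φ x) (a b : E) :
    fderiv ℝ (fderiv ℝ (fun y => w (Φ y))) x a b =
      fderiv ℝ (fderiv ℝ w) (Φ x) (fderiv ℝ Φ x a) (fderiv ℝ Φ x b) +
        fderiv ℝ w (Φ x) (fderiv ℝ (fderiv ℝ Φ) x a b) := by
  have hev : fderiv ℝ (fun y => w (Φ y)) =ᶠ[𝓝 x]
      fun y => (fderiv ℝ w (Φ y)).comp (fderiv ℝ Φ y) := by
    filter_upwards [hΦ.continuousAt.eventually hw.eventually_contDiffAt_two,
      hΦ.eventually_contDiffAt_two] with y hy hy'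
    exact fderiv_comp y (hy.differentiableAt (by norm_num)) (hy'.differentiableAt (by norm_num))
  rw [hev.fderiv_eq]
  have h1 : HasFDerivAt (fun y => fderiv ℝ w (Φ y)) _ x :=
    hw.differentiableAt_fderiv.hasFDerivAt.comp x
      (hΦ.differentiableAt (by norm_num)).hasFDerivAt
  rw [(h1.clm_comp hΦ.differentiableAt_fderiv.hasFDerivAt).fderiv]
  simp [add_comm]

lemma norm_fderiv_comp_le {w : F → G} {Φ : E → F} {x : E} (hw : DifferentiableAt ℝ w (Φ x))
    (hΦ : DifferentiableAt ℝ Φ x) :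
    ‖fderiv ℝ (fun y => w (Φ y)) x‖ ≤ ‖fderiv ℝ w (Φ x)‖ * ‖fderiv ℝ Φ x‖ := by
  have := fderiv_comp x hw hΦ
  rw [Function.comp_def] at this
  rw [this]
  exact ContinuousLinearMap.opNorm_comp_le _ _

lemma norm_fderiv_fderiv_comp_le {w : F → G} {Φ : E → F} {x : E}
    (hw : ContDiffAt ℝ 2 w (Φ x)) (hΦ : ContDiffAt ℝ 2 Φ x) :
    ‖fderiv ℝ (fderiv ℝ (fun y => w (Φ y))) x‖ ≤
      ‖fderiv ℝ (fderiv ℝ w) (Φ x)‖ * ‖fderiv ℝ Φ x‖ ^ 2 +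
        ‖fderiv ℝ w (Φ x)‖ * ‖fderiv ℝ (fderiv ℝ Φ) x‖ := by
  refine ContinuousLinearMap.opNorm_le_bound₂ _ (by positivity) fun a b => ?_
  rw [fderiv_fderiv_comp hw hΦ]
  calc _ ≤ ‖fderiv ℝ (fderiv ℝ w) (Φ x) (fderiv ℝ Φ x a) (fderiv ℝ Φ x b)‖ +
        ‖fderiv ℝ w (Φ x) (fderiv ℝ (fderiv ℝ Φ) x a b)‖ := norm_add_le _ _
    _ ≤ ‖fderiv ℝ (fderiv ℝ w) (Φ x)‖ * (‖fderiv ℝ Φ x‖ * ‖a‖) * (‖fderiv ℝ Φ x‖ * ‖b‖) +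
        ‖fderiv ℝ w (Φ x)‖ * (‖fderiv ℝ (fderiv ℝ Φ) x‖ * ‖a‖ * ‖b‖) := by
      gcongr
      · refine (ContinuousLinearMap.le_opNorm₂ _ _ _).trans ?_
        gcongr <;> exact ContinuousLinearMap.le_opNorm _ _
      · refine (ContinuousLinearMap.le_opNorm _ _).trans ?_
        gcongr
        exact ContinuousLinearMap.le_opNorm₂ _ _ _
    _ = _ := by ring

lemma fderiv_fderiv_clm_apply {L : E → F →L[ℝ] G} {φ : E → F} {x : E}
    (hL : ContDiffAt ℝ 2 L x) (hφ : ContDiffAt ℝ 2 φ x) (a b : E) :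
    fderiv ℝ (fderiv ℝ (fun y => L y (φ y))) x a b =
      L x (fderiv ℝ (fderiv ℝ φ) x a b) + fderiv ℝ L x a (fderiv ℝ φ x b) +
        fderiv ℝ L x b (fderiv ℝ φ x a) + fderiv ℝ (fderiv ℝ L) x a b (φ x) := by
  have hu : ContDiffAt ℝ 2 (fun y => L y (φ y)) x := hL.clm_apply hφ
  rw [← fderiv_fderiv_apply_const hu.differentiableAt_fderiv]
  have hev : (fun y => fderiv ℝ (fun y => L y (φ y)) y b) =ᶠ[𝓝 x]
      fun y => L y (fderiv ℝ φ y b) + fderiv ℝ L y b (φ y) := by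
    filter_upwards [hL.eventually_contDiffAt_two, hφ.eventually_contDiffAt_two] with y hy hy'
    rw [fderiv_clm_apply (hy.differentiableAt (by norm_num))
      (hy'.differentiableAt (by norm_num))]
    simp
  rw [hev.fderiv_eq]
  have hL1 := hL.differentiableAt (by norm_num)
  have hφ1 := hφ.differentiableAt (by norm_num)
  have hφ2 : DifferentiableAt ℝ (fun y => fderiv ℝ φ y b) x :=
    hφ.differentiableAt_fderiv.clm_apply (differentiableAt_const b)
  have hL2 : DifferentiableAt ℝ (fun y => fderiv ℝ L y b) x :=
    hL.differentiableAt_fderiv.clm_apply (differentiableAt_const b)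
  rw [fderiv_fun_add (hL1.clm_apply hφ2) (hL2.clm_apply hφ1),
    fderiv_clm_apply hL1 hφ2, fderiv_clm_apply hL2 hφ1]
  simp only [_root_.add_apply, ContinuousLinearMap.coe_comp,
    Function.comp_apply, ContinuousLinearMap.flip_apply,
    fderiv_fderiv_apply_const hφ.differentiableAt_fderiv,
    fderiv_fderiv_apply_const hL.differentiableAt_fderiv]
  abel

lemma norm_fderiv_fderiv_clm_apply_le {L : E → F →L[ℝ] G} {φ : E → F} {x : E}
    (hL : ContDiffAt ℝ 2 L x) (hφ : ContDiffAt ℝ 2 φ x) :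
    ‖fderiv ℝ (fderiv ℝ (fun y => L y (φ y))) x‖ ≤
      ‖L x‖ * ‖fderiv ℝ (fderiv ℝ φ) x‖ + 2 * (‖fderiv ℝ L x‖ * ‖fderiv ℝ φ x‖) +
        ‖fderiv ℝ (fderiv ℝ L) x‖ * ‖φ x‖ := by
  refine ContinuousLinearMap.opNorm_le_bound₂ _ (by positivity) fun a b => ?_
  rw [fderiv_fderiv_clm_apply hL hφ]
  have h1 : ‖L x (fderiv ℝ (fderiv ℝ φ) x a b)‖ ≤
      ‖L x‖ * (‖fderiv ℝ (fderiv ℝ φ) x‖ * ‖a‖ * ‖b‖) :=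
    (ContinuousLinearMap.le_opNorm _ _).trans
      (by gcongr; exact ContinuousLinearMap.le_opNorm₂ _ _ _)
  have h2 (a b : E) : ‖fderiv ℝ L x a (fderiv ℝ φ x b)‖ ≤
      ‖fderiv ℝ L x‖ * ‖a‖ * (‖fderiv ℝ φ x‖ * ‖b‖) :=
    (ContinuousLinearMap.le_opNorm₂ _ _ _).trans
      (by gcongr; exact ContinuousLinearMap.le_opNorm _ _)
  have h3 : ‖fderiv ℝ (fderiv ℝ L) x a b (φ x)‖ ≤
      ‖fderiv ℝ (fderiv ℝ L) x‖ * ‖a‖ * ‖b‖ * ‖φ x‖ :=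
    (ContinuousLinearMap.le_opNorm _ _).trans
      (by gcongr; exact ContinuousLinearMap.le_opNorm₂ _ _ _)
  have h4 := norm_add₄_le (a := L x (fderiv ℝ (fderiv ℝ φ) x a b))
    (b := fderiv ℝ L x a (fderiv ℝ φ x b)) (c := fderiv ℝ L x b (fderiv ℝ φ x a))
    (d := fderiv ℝ (fderiv ℝ L) x a b (φ x))
  linarith [h2 a b, h2 b a]

lemma norm_fderiv_clm_apply_le {L : E → F →L[ℝ] G} {φ : E → F} {x : E}
    (hL : DifferentiableAt ℝ L x) (hφ : DifferentiableAt ℝ φ x) :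
    ‖fderiv ℝ (fun y => L y (φ y)) x‖ ≤
      ‖L x‖ * ‖fderiv ℝ φ x‖ + ‖fderiv ℝ L x‖ * ‖φ x‖ := by
  refine ContinuousLinearMap.opNorm_le_bound _ (by positivity) fun a => ?_
  rw [fderiv_clm_apply hL hφ]
  have h1 : ‖L x (fderiv ℝ φ x a)‖ ≤ ‖L x‖ * (‖fderiv ℝ φ x‖ * ‖a‖) :=
    (ContinuousLinearMap.le_opNorm _ _).trans
      (by gcongr; exact ContinuousLinearMap.le_opNorm _ _)
  have h2 : ‖fderiv ℝ L x a (φ x)‖ ≤ ‖fderiv ℝ L x‖ * ‖a‖ * ‖φ x‖ :=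
    ContinuousLinearMap.le_opNorm₂ _ _ _
  exact (norm_add_le _ _).trans ((add_le_add h1 h2).trans_eq (by ring))

lemma fderiv_fderiv_fderiv_comm {w : E → F} {x : E} (hw : ContDiffAt ℝ 3 w x) (v c : E) :
    fderiv ℝ (fderiv ℝ (fderiv ℝ w)) x v v c = fderiv ℝ (fderiv ℝ (fderiv ℝ w)) x c v v := by
  have hL : ContDiffAt ℝ 2 (fderiv ℝ w) x := hw.fderiv_right (by norm_num)
  have hD := hL.differentiableAt_fderiv
  have hc2 (a b : E) : fderiv ℝ (fun y => fderiv ℝ (fderiv ℝ w) y a b) x =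
      ((fderiv ℝ (fderiv ℝ (fderiv ℝ w)) x).flip a).flip b := by
    rw [fderiv_clm_apply (hD.clm_apply (differentiableAt_const a)) (differentiableAt_const b)]
    ext d
    simp [fderiv_fderiv_apply_const hD]
  have hev : (fun y => fderiv ℝ (fderiv ℝ w) y v c) =ᶠ[𝓝 x]
      fun y => fderiv ℝ (fderiv ℝ w) y c v := by
    have hev3 : ∀ᶠ y in 𝓝 x, ContDiffAt ℝ 3 w y := hw.eventually (by simp)
    filter_upwards [hev3] with y hy
    exact ((hy.of_le (m := 2) (by norm_num)).isSymmSndFDerivAt (by simp)).eq v c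
  have h1 := congrArg (fun M : E →L[ℝ] F => M v) hev.fderiv_eq
  simp only [hc2, ContinuousLinearMap.flip_apply] at h1
  rw [h1]
  have h2 := (hL.isSymmSndFDerivAt (by simp)).eq v c
  rw [h2]

end Calculus

section HolderClass

set_option linter.unusedSectionVars false

variable {E : Type} [NormedAddCommGroup E] [NormedSpace ℝ E]
  {F : Type} [NormedAddCommGroup F] [NormedSpace ℝ F]
  {G : Type} [NormedAddCommGroup G] [NormedSpace ℝ G]
  {H : Type} [NormedAddCommGroup H] [NormedSpace ℝ H]

/-- Local Hölder continuity of exponent `α` at every point of `U`. -/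
def LocHolder (α : ℝ) (U : Set E) (f : E → F) : Prop :=
  ∀ x ∈ U, ∃ C : ℝ, ∀ᶠ s in (𝓝 x).smallSets, ∀ y ∈ s, ∀ z ∈ s, ‖f y - f z‖ ≤ C * ‖y - z‖ ^ α

lemma LocHolder.continuousAt {α : ℝ} (hα : 0 < α) {U : Set E} {f : E → F}
    (hf : LocHolder α U f) {x : E} (hx : x ∈ U) : ContinuousAt f x := by
  obtain ⟨C, hC⟩ := hf x hx
  obtain ⟨s, hs, hC⟩ := eventually_smallSets.1 hC
  have hC := hC s subset_rfl
  refine tendsto_iff_norm_sub_tendsto_zero.2 ?_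
  refine squeeze_zero' (g := fun y => C * ‖y - x‖ ^ α) (.of_forall fun _ => norm_nonneg _)
    (by filter_upwards [hs] with y hy using hC y hy x (mem_of_mem_nhds hs)) ?_
  have h1 : Tendsto (fun y => ‖y - x‖) (𝓝 x) (𝓝 0) := by
    have : Continuous fun y => ‖y - x‖ := by fun_prop
    simpa using this.tendsto x
  have h2 := (h1.rpow_const (p := α) (Or.inr hα.le)).const_mul C
  simpa [Real.zero_rpow hα.ne'] using h2

lemma LocHolder.congr {α : ℝ} {U : Set E} (hU : IsOpen U) {f g : E → F}
    (hf : LocHolder α U f) (h : EqOn f g U) : LocHolder α U g := by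
  intro x hx
  obtain ⟨C, hC⟩ := hf x hx
  refine ⟨C, ?_⟩
  have hU' : ∀ᶠ s in (𝓝 x).smallSets, s ⊆ U := eventually_smallSets_subset.2 (hU.mem_nhds hx)
  filter_upwards [hC, hU'] with s hs hsU y hy z hz
  rw [← h (hsU hy), ← h (hsU hz)]
  exact hs y hy z hz

lemma LocHolder.isometry_comp {α : ℝ} {U : Set E} {f : E → F} (L : F →ₗᵢ[ℝ] G) :
    LocHolder α U (fun x => L (f x)) ↔ LocHolder α U f := by
  simp only [LocHolder, ← map_sub, L.norm_map]

lemma LocHolder.bilinear {α : ℝ} (hα : 0 < α) {U : Set E} (B : F →L[ℝ] G →L[ℝ] H)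
    {f : E → F} {g : E → G} (hf : LocHolder α U f) (hg : LocHolder α U g) :
    LocHolder α U (fun x => B (f x) (g x)) := by
  intro x hx
  obtain ⟨C, hC⟩ := hf x hx
  obtain ⟨C', hC'⟩ := hg x hx
  have hbf : ∀ᶠ s in (𝓝 x).smallSets, ∀ y ∈ s, ‖f y‖ < ‖f x‖ + 1 :=
    ((hf.continuousAt hα hx).norm.eventually_lt_const (lt_add_one _)).smallSets
  have hbg : ∀ᶠ s in (𝓝 x).smallSets, ∀ y ∈ s, ‖g y‖ < ‖g x‖ + 1 :=
    ((hg.continuousAt hα hx).norm.eventually_lt_const (lt_add_one _)).smallSets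
  refine ⟨‖B‖ * (‖f x‖ + 1) * C' + ‖B‖ * C * (‖g x‖ + 1), ?_⟩
  filter_upwards [hC, hC', hbf, hbg] with s h1 h2 h3 h4 y hy z hz
  have : B (f y) (g y) - B (f z) (g z) = B (f y) (g y - g z) + B (f y - f z) (g z) := by simp
  rw [this]
  have e1 : ‖B (f y) (g y - g z)‖ ≤ ‖B‖ * (‖f x‖ + 1) * (C' * ‖y - z‖ ^ α) := by
    refine (B.le_opNorm₂ _ _).trans ?_
    gcongr
    exacts [(h3 y hy).le, h2 y hy z hz]
  have e2 : ‖B (f y - f z) (g z)‖ ≤ ‖B‖ * (C * ‖y - z‖ ^ α) * (‖g x‖ + 1) := by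
    refine (B.le_opNorm₂ _ _).trans ?_
    have := (norm_nonneg _).trans (h1 y hy z hz)
    gcongr
    exacts [h1 y hy z hz, (h4 z hz).le]
  refine (norm_add_le _ _).trans ((add_le_add e1 e2).trans_eq (by ring))

lemma LocHolder.add {α : ℝ} {U : Set E} {f g : E → F} (hf : LocHolder α U f)
    (hg : LocHolder α U g) : LocHolder α U (fun x => f x + g x) := by
  intro x hx
  obtain ⟨C, hC⟩ := hf x hx
  obtain ⟨C', hC'⟩ := hg x hx
  refine ⟨C + C', ?_⟩
  filter_upwards [hC, hC'] with s h1 h2 y hy z hz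
  rw [add_sub_add_comm, add_mul]
  exact (norm_add_le _ _).trans (add_le_add (h1 y hy z hz) (h2 y hy z hz))

lemma LocHolder.of_contDiffOn {α : ℝ} (hα : α ≤ 1) {U : Set E} (hU : IsOpen U)
    {f : E → F} (hf : ContDiffOn ℝ 1 f U) : LocHolder α U f := by
  intro x hx
  obtain ⟨K, t, ht, hK⟩ := (hf.contDiffAt (hU.mem_nhds hx)).exists_lipschitzOnWith
  refine ⟨K, ?_⟩
  have h1 : ∀ᶠ s in (𝓝 x).smallSets, s ⊆ t := eventually_smallSets_subset.2 ht
  have h2 : ∀ᶠ s in (𝓝 x).smallSets, s ⊆ Metric.ball x (1 / 2) :=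
    eventually_smallSets_subset.2 (Metric.ball_mem_nhds x (by norm_num))
  filter_upwards [h1, h2] with s h1 h2 y hy z hz
  refine (hK.norm_sub_le (h1 hy) (h1 hz)).trans ?_
  gcongr
  have hd : ‖y - z‖ ≤ 1 := by
    rw [← dist_eq_norm]
    have := dist_triangle_right y z x
    have := Metric.mem_ball.1 (h2 hy)
    have := Metric.mem_ball.1 (h2 hz)
    linarith
  exact Real.self_le_rpow_of_le_one (norm_nonneg _) hd hα

/-- The class `C^{k,α}_loc(U)`. -/
def HolderClass (α : ℝ) (U : Set E) (k : ℕ) (f : E → F) : Prop :=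
  ContDiffOn ℝ k f U ∧ LocHolder α U (iteratedFDeriv ℝ k f)

lemma holderClass_zero {α : ℝ} (hα : 0 < α) {U : Set E} {f : E → F} :
    HolderClass α U 0 f ↔ LocHolder α U f := by
  have : LocHolder α U (iteratedFDeriv ℝ 0 f) ↔ LocHolder α U f := by
    rw [iteratedFDeriv_zero_eq_comp]
    exact LocHolder.isometry_comp
      (continuousMultilinearCurryFin0 ℝ E F).symm.toLinearIsometry
  refine ⟨fun h => this.1 h.2, fun h => ⟨?_, this.2 h⟩⟩
  exact contDiffOn_zero.2 fun x hx => (h.continuousAt hα hx).continuousWithinAt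

lemma holderClass_succ {α : ℝ} {U : Set E} (hU : IsOpen U) {k : ℕ} {f : E → F} :
    HolderClass α U (k + 1) f ↔ DifferentiableOn ℝ f U ∧ HolderClass α U k (fderiv ℝ f) := by
  have key : ∀ y z, ‖iteratedFDeriv ℝ (k + 1) f y - iteratedFDeriv ℝ (k + 1) f z‖ =
      ‖iteratedFDeriv ℝ k (fderiv ℝ f) y - iteratedFDeriv ℝ k (fderiv ℝ f) z‖ := by
    intro y z
    rw [iteratedFDeriv_succ_eq_comp_right, iteratedFDeriv_succ_eq_comp_right,
      ← dist_eq_norm, ← dist_eq_norm]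
    exact (continuousMultilinearCurryRightEquiv' ℝ k E F).symm.dist_map _ _
  have : LocHolder α U (iteratedFDeriv ℝ (k + 1) f) ↔
      LocHolder α U (iteratedFDeriv ℝ k (fderiv ℝ f)) := by
    simp only [LocHolder, key]
  rw [HolderClass, HolderClass, this]
  push_cast
  rw [contDiffOn_succ_iff_fderiv_of_isOpen hU]
  simp [and_assoc]

lemma HolderClass.congr {α : ℝ} {U : Set E} (hU : IsOpen U) {k : ℕ} {f g : E → F}
    (hf : HolderClass α U k f) (h : EqOn f g U) : HolderClass α U k g := by
  refine ⟨hf.1.congr fun x hx => (h hx).symm, hf.2.congr hU fun x hx => ?_⟩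
  exact ((h.eventuallyEq_of_mem (hU.mem_nhds hx)).iteratedFDeriv ℝ k).eq_of_nhds

lemma HolderClass.add {α : ℝ} {U : Set E} (hU : IsOpen U) {k : ℕ} {f g : E → F}
    (hf : HolderClass α U k f) (hg : HolderClass α U k g) :
    HolderClass α U k (fun x => f x + g x) := by
  refine ⟨hf.1.add hg.1, (hf.2.add hg.2).congr hU fun x hx => ?_⟩
  exact (iteratedFDeriv_add_apply (hf.1.contDiffAt (hU.mem_nhds hx))
    (hg.1.contDiffAt (hU.mem_nhds hx))).symm

lemma HolderClass.of_succ {α : ℝ} (hα : α ≤ 1) {U : Set E} (hU : IsOpen U) {k : ℕ}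
    {f : E → F} (hf : ContDiffOn ℝ (k + 1 : ℕ) f U) : HolderClass α U k f := by
  refine ⟨hf.of_le (by exact_mod_cast k.le_succ), .of_contDiffOn hα hU ?_⟩
  exact fun x hx => ((hf.contDiffAt (hU.mem_nhds hx)).iteratedFDeriv_right (m := 1) (i := k)
    (by push_cast; rw [add_comm])).contDiffWithinAt

lemma HolderClass.bilinear {α : ℝ} (hα : 0 < α) (hα' : α ≤ 1) {U : Set E} (hU : IsOpen U)
    {k : ℕ} {F G H : Type} [NormedAddCommGroup F] [NormedSpace ℝ F]
    [NormedAddCommGroup G] [NormedSpace ℝ G] [NormedAddCommGroup H] [NormedSpace ℝ H]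
    (B : F →L[ℝ] G →L[ℝ] H) {f : E → F} {g : E → G}
    (hf : HolderClass α U k f) (hg : HolderClass α U k g) :
    HolderClass α U k (fun x => B (f x) (g x)) := by
  induction k generalizing F G H with
  | zero =>
    rw [holderClass_zero hα] at *
    exact hf.bilinear hα B hg
  | succ k ih =>
    have hf0 := HolderClass.of_succ hα' hU hf.1
    have hg0 := HolderClass.of_succ hα' hU hg.1
    rw [holderClass_succ hU] at *
    have hd : ∀ x ∈ U, HasFDerivAt (fun x => B (f x) (g x)) _ x := fun x hx =>
      B.hasFDerivAt_of_bilinear (hf.1.differentiableAt (hU.mem_nhds hx)).hasFDerivAt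
        (hg.1.differentiableAt (hU.mem_nhds hx)).hasFDerivAt
    refine ⟨fun x hx => (hd x hx).differentiableAt.differentiableWithinAt, ?_⟩
    exact ((ih (B.precompR E) hf0 hg.2).add hU (ih (B.precompL E) hf.2 hg0)).congr hU
      fun x hx => (hd x hx).fderiv.symm

lemma HolderClass.comp_real {α : ℝ} (hα : 0 < α) (hα' : α ≤ 1) {U : Set E} (hU : IsOpen U)
    {k : ℕ} {θ : ℝ → ℝ} (hθ : ∀ m : ℕ, ContDiff ℝ m θ) {g : E → ℝ}
    (hg : HolderClass α U k g) : HolderClass α U k (fun x => θ (g x)) := by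
  induction k generalizing θ with
  | zero =>
    rw [holderClass_zero hα] at *
    intro x hx
    obtain ⟨C, hC⟩ := hg x hx
    obtain ⟨K, t, ht, hK⟩ := ((hθ 1).contDiffAt (x := g x)).exists_lipschitzOnWith
    have h1 : ∀ᶠ s in (𝓝 x).smallSets, ∀ y ∈ s, g y ∈ t :=
      ((hg.continuousAt hα hx).eventually_mem ht).smallSets
    refine ⟨K * C, ?_⟩
    filter_upwards [hC, h1] with s hs h1 y hy z hz
    refine (hK.norm_sub_le (h1 y hy) (h1 z hz)).trans ?_
    rw [mul_assoc]
    gcongr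
    exact hs y hy z hz
  | succ k ih =>
    have hg0 := HolderClass.of_succ hα' hU hg.1
    have hθ' : ∀ m : ℕ, ContDiff ℝ m (deriv θ) := fun m =>
      (contDiff_succ_iff_deriv.1 (by exact_mod_cast hθ (m + 1))).2.2
    rw [holderClass_succ hU] at hg ⊢
    have hd : ∀ x ∈ U, HasFDerivAt (fun x => θ (g x)) (deriv θ (g x) • fderiv ℝ g x) x :=
      fun x hx => (((hθ 1).differentiable (by norm_num)) (g x)).hasDerivAt.comp_hasFDerivAt x
        (hg.1.differentiableAt (hU.mem_nhds hx)).hasFDerivAt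
    refine ⟨fun x hx => (hd x hx).differentiableAt.differentiableWithinAt, ?_⟩
    exact (HolderClass.bilinear hα hα' hU (ContinuousLinearMap.lsmul ℝ ℝ)
      (ih hθ' hg0) hg.2).congr hU fun x hx => (hd x hx).fderiv.symm

lemma HolderClass.of_holderOnWith {α : ℝ≥0} {U : Set E} {k : ℕ}
    {f : E → F} (hf : ContDiffOn ℝ k f U)
    (h : ∀ x ∈ U, ∃ s ∈ 𝓝 x, s ⊆ U ∧ ∃ C : ℝ≥0, HolderOnWith C α (iteratedFDeriv ℝ k f) s) :
    HolderClass α U k f := by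
  refine ⟨hf, fun x hx => ?_⟩
  obtain ⟨s, hs, -, C, hC⟩ := h x hx
  refine ⟨C, ?_⟩
  filter_upwards [eventually_smallSets_subset.2 hs] with t ht y hy z hz
  rw [← dist_eq_norm, ← dist_eq_norm]
  have := hC y (ht hy) z (ht hz)
  rw [edist_nndist, edist_nndist, ← ENNReal.coe_rpow_of_nonneg _ (NNReal.coe_nonneg α), ← ENNReal.coe_mul,
    ENNReal.coe_le_coe] at this
  exact_mod_cast this

lemma HolderClass.exists_holderOnWith {α : ℝ≥0} {U : Set E} (hU : IsOpen U) {k : ℕ}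
    {f : E → F} (hf : HolderClass α U k f) :
    ∀ x ∈ U, ∃ s ∈ 𝓝 x, s ⊆ U ∧ ∃ C : ℝ≥0, HolderOnWith C α (iteratedFDeriv ℝ k f) s := by
  intro x hx
  obtain ⟨C, hC⟩ := hf.2 x hx
  obtain ⟨s, hs, h⟩ := eventually_smallSets.1
    (hC.and (eventually_smallSets_subset.2 (hU.mem_nhds hx)))
  refine ⟨s, hs, (h s subset_rfl).2, C.toNNReal, fun y hy z hz => ?_⟩
  have := (h s subset_rfl).1 y hy z hz
  rw [edist_nndist, edist_nndist, ← ENNReal.coe_rpow_of_nonneg _ (NNReal.coe_nonneg α), ← ENNReal.coe_mul,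
    ENNReal.coe_le_coe, ← NNReal.coe_le_coe]
  push_cast
  rw [dist_eq_norm, dist_eq_norm]
  refine this.trans ?_
  gcongr
  exact le_max_left _ _

end HolderClass

lemma exists_abs_deriv_smoothTransition_le :
    ∃ C : ℝ, 0 ≤ C ∧ ∀ x, |deriv Real.smoothTransition x| ≤ C := by
  have hc : Continuous (deriv Real.smoothTransition) :=
    (Real.smoothTransition.contDiff (n := 1)).continuous_deriv (by norm_num)
  obtain ⟨C, hC⟩ := isCompact_Icc.exists_bound_of_continuousOn (s := Icc (0 : ℝ) 1) hc.continuousOn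
  refine ⟨C, (norm_nonneg _).trans (hC 0 (by simp)), fun x => ?_⟩
  by_cases hx : x ∈ Icc (0 : ℝ) 1
  · exact hC x hx
  have h0 : deriv Real.smoothTransition x = 0 := by
    rcases not_and_or.1 hx with h | h
    · have : Real.smoothTransition =ᶠ[𝓝 x] fun _ => 0 := by
        filter_upwards [Iio_mem_nhds (not_le.1 h)] with y hy
        exact Real.smoothTransition.zero_of_nonpos (le_of_lt hy)
      rw [this.deriv_eq, deriv_const]
    · have : Real.smoothTransition =ᶠ[𝓝 x] fun _ => 1 := by
        filter_upwards [Ioi_mem_nhds (not_le.1 h)] with y hy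
        exact Real.smoothTransition.one_of_one_le (le_of_lt hy)
      rw [this.deriv_eq, deriv_const]
  rw [h0, abs_zero]
  exact (norm_nonneg _).trans (hC 0 (by simp))

lemma deriv_smoothTransition_eq_zero {x : ℝ} (hx : 1 < x) :
    deriv Real.smoothTransition x = 0 := by
  have : Real.smoothTransition =ᶠ[𝓝 x] fun _ => 1 := by
    filter_upwards [Ioi_mem_nhds hx] with y hy
    exact Real.smoothTransition.one_of_one_le (le_of_lt hy)
  rw [this.deriv_eq, deriv_const]

/-- A smooth function that is the identity on `(-∞, δ]` and constant on `[2δ, ∞)`. Subtracting it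
from the identity gives a convex function flattening `[0, δ]`. -/
structure IsTruncation (C δ : ℝ) (θ : ℝ → ℝ) : Prop where
  smooth : ∀ m : ℕ, ContDiff ℝ m θ
  convex : ConvexOn ℝ univ fun s => s - θ s
  mono : Monotone fun s => s - θ s
  eq_self : ∀ s ≤ δ, θ s = s
  eq_const : ∀ s, 2 * δ ≤ s → θ s = θ (2 * δ)
  abs_le : ∀ s, 0 ≤ s → |θ s| ≤ 2 * δ
  abs_deriv_le : ∀ s, |deriv θ s| ≤ 1
  abs_deriv_deriv_le : ∀ s, |deriv (deriv θ) s| ≤ C / δ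
  abs_deriv_deriv_mul_le : ∀ s, 0 ≤ s → |deriv (deriv θ) s| * s ≤ C

lemma exists_isTruncation : ∃ C : ℝ, 0 ≤ C ∧ ∀ δ : ℝ, 0 < δ → ∃ θ, IsTruncation C δ θ := by
  obtain ⟨C, hC0, hC⟩ := exists_abs_deriv_smoothTransition_le
  refine ⟨2 * C, by positivity, fun δ hδ => ?_⟩
  let k : ℝ → ℝ := fun s => 1 - Real.smoothTransition (s / δ - 1)
  have hks : ∀ m : ℕ, ContDiff ℝ m k := fun m =>
    contDiff_const.sub ((Real.smoothTransition.contDiff (n := m)).comp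
      ((contDiff_id.div_const δ).sub contDiff_const))
  have hkc : Continuous k := (hks 0).continuous
  have hk0 : ∀ s, 0 ≤ k s := fun s => sub_nonneg.2 (Real.smoothTransition.le_one _)
  have hk1 : ∀ s, k s ≤ 1 := fun s => sub_le_self _ (Real.smoothTransition.nonneg _)
  have hkl : ∀ s ≤ δ, k s = 1 := fun s hs => by
    simp only [k]
    rw [Real.smoothTransition.zero_of_nonpos, sub_zero]
    rw [sub_nonpos, div_le_one hδ]
    exact hs
  have hkr : ∀ s, 2 * δ ≤ s → k s = 0 := fun s hs => by
    simp only [k]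
    rw [Real.smoothTransition.one_of_one_le, sub_self]
    rw [le_sub_iff_add_le, le_div_iff₀ hδ]
    linarith
  let θ : ℝ → ℝ := fun s => ∫ r in (0 : ℝ)..s, k r
  have hd : ∀ s, HasDerivAt θ (k s) s := fun s =>
    intervalIntegral.integral_hasDerivAt_right (hkc.intervalIntegrable _ _)
      (hkc.stronglyMeasurableAtFilter _ _) hkc.continuousAt
  have hdθ : deriv θ = k := funext fun s => (hd s).deriv
  have hdk : ∀ s, deriv k s = -(deriv Real.smoothTransition (s / δ - 1) / δ) := fun s => by
    have h1 : HasDerivAt (fun s => s / δ - 1) (1 / δ) s :=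
      ((hasDerivAt_id s).div_const δ).sub_const 1
    have h2 := ((Real.smoothTransition.contDiff (n := 1)).differentiable (by norm_num)
      (s / δ - 1)).hasDerivAt
    have h3 := (h2.comp s h1).const_sub 1
    rw [show deriv k s = _ from h3.deriv]
    ring
  have hdψ : ∀ s, HasDerivAt (fun s => s - θ s) (1 - k s) s := fun s =>
    (hasDerivAt_id s).sub (hd s)
  have hdψ' : deriv (fun s => s - θ s) = fun s => 1 - k s := funext fun s => (hdψ s).deriv
  have hconst : ∀ s, 2 * δ ≤ s → θ s = θ (2 * δ) := fun s hs => by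
    have h1 := intervalIntegral.integral_add_adjacent_intervals
      (hkc.intervalIntegrable (μ := volume) 0 (2 * δ)) (hkc.intervalIntegrable (2 * δ) s)
    have h2 : ∫ r in (2 * δ)..s, k r = 0 := by
      rw [intervalIntegral.integral_congr (g := fun _ => 0)]
      · simp
      · intro r hr
        rw [uIcc_of_le hs] at hr
        exact hkr r hr.1
    rw [h2, add_zero] at h1
    exact h1.symm
  have hle : ∀ s, |θ s| ≤ |s| := fun s => by
    have := intervalIntegral.norm_integral_le_of_norm_le_const (a := 0) (b := s) (f := k) (C := 1)
      (fun r _ => by rw [Real.norm_eq_abs, abs_of_nonneg (hk0 r)]; exact hk1 r)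
    simpa using this
  refine ⟨θ, ?_, ?_, ?_, ?_, hconst, ?_, ?_, ?_, ?_⟩
  · intro m
    have : ContDiff ℝ (m + 1) θ := contDiff_succ_iff_deriv.2
      ⟨fun s => (hd s).differentiableAt, by simp, by rw [hdθ]; exact hks m⟩
    exact this.of_le (by exact_mod_cast m.le_succ)
  · refine MonotoneOn.convexOn_of_deriv convex_univ
      (fun s _ => (hdψ s).continuousAt.continuousWithinAt)
      (fun s _ => (hdψ s).differentiableAt.differentiableWithinAt) ?_
    rw [hdψ']
    intro a _ b _ hab
    simp only [k, sub_sub_cancel]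
    apply Real.smoothTransition.monotone
    gcongr
  · refine monotone_of_deriv_nonneg (fun s => (hdψ s).differentiableAt) fun s => ?_
    rw [hdψ']
    exact sub_nonneg.2 (hk1 s)
  · intro s hs
    simp only [θ]
    rw [intervalIntegral.integral_congr (g := fun _ => 1)]
    · simp
    · intro r hr
      refine hkl r ?_
      rcases le_total 0 s with h | h
      · rw [uIcc_of_le h] at hr; linarith [hr.2]
      · rw [uIcc_of_ge h] at hr; linarith [hr.2]
  · intro s hs
    rcases le_total s (2 * δ) with h | h
    · exact (hle s).trans (by rwa [abs_of_nonneg hs])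
    · rw [hconst s h]
      exact (hle _).trans (abs_of_nonneg (by positivity)).le
  · intro s
    rw [hdθ, abs_of_nonneg (hk0 s)]
    exact hk1 s
  · intro s
    rw [hdθ, hdk, abs_neg, abs_div, abs_of_pos hδ]
    gcongr
    linarith [hC (s / δ - 1)]
  · intro s hs
    rw [hdθ, hdk, abs_neg, abs_div, abs_of_pos hδ]
    rcases le_or_gt s (2 * δ) with h | h
    · have hs2 : s / δ ≤ 2 := (div_le_iff₀ hδ).2 h
      calc _ = |deriv Real.smoothTransition (s / δ - 1)| * (s / δ) := by ring
        _ ≤ C * 2 := by gcongr; exact hC _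
        _ = 2 * C := mul_comm _ _
    · rw [deriv_smoothTransition_eq_zero]
      · simpa using hC0
      · rw [lt_sub_iff_add_lt, lt_div_iff₀ hδ]
        linarith

section Taylor

set_option maxSynthPendingDepth 3

variable {E F : Type*} [NormedAddCommGroup E] [NormedSpace ℝ E]
  [NormedAddCommGroup F] [NormedSpace ℝ F]

lemma ConvexOn.add_fderiv_le {s : Set E} {f : E → ℝ} (hf : ConvexOn ℝ s f) {x y : E}
    (hx : x ∈ s) (hy : y ∈ s) (hd : DifferentiableAt ℝ f x) :
    f x + fderiv ℝ f x (y - x) ≤ f y := by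
  have hg : HasDerivAt (fun t : ℝ => f (x + t • (y - x))) (fderiv ℝ f x (y - x)) 0 := by
    have h1 : HasDerivAt (fun t : ℝ => x + t • (y - x)) (y - x) 0 := by
      simpa using ((hasDerivAt_id (0 : ℝ)).smul_const (y - x)).const_add x
    have h2 : HasFDerivAt f (fderiv ℝ f x) (x + (0 : ℝ) • (y - x)) := by
      simpa using hd.hasFDerivAt
    exact h2.comp_hasDerivAt 0 h1
  have ht := hg.tendsto_slope_zero_right
  have hle : fderiv ℝ f x (y - x) ≤ f y - f x := by
    refine le_of_tendsto ht ?_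
    filter_upwards [Ioo_mem_nhdsGT (zero_lt_one' ℝ)] with t ht
    have := hf.2 hx hy (sub_nonneg.2 ht.2.le) ht.1.le (by ring)
    have he : (1 - t) • x + t • y = x + t • (y - x) := by module
    rw [he] at this
    simp only [zero_add, zero_smul, add_zero, smul_eq_mul] at this ⊢
    rw [inv_mul_le_iff₀ ht.1]
    linarith
  linarith

lemma ConvexOn.fderiv_fderiv_nonneg {s : Set E} (hs : IsOpen s) {f : E → ℝ}
    (hf : ConvexOn ℝ s f) (hd : ContDiffOn ℝ 2 f s) {x : E} (hx : x ∈ s) (u : E) :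
    0 ≤ fderiv ℝ (fderiv ℝ f) x u u := by
  have hfx : ∀ y ∈ s, ContDiffAt ℝ 2 f y := fun y hy => hd.contDiffAt (hs.mem_nhds hy)
  have h1 : HasDerivAt (fun t : ℝ => x + t • u) u 0 := by
    simpa using ((hasDerivAt_id (0 : ℝ)).smul_const u).const_add x
  have hg : HasDerivAt (fun t : ℝ => fderiv ℝ f (x + t • u) u)
      (fderiv ℝ (fderiv ℝ f) x u u) 0 := by
    have hd' := (hfx x hx).differentiableAt_fderiv
    have h2 : HasFDerivAt (fun y => fderiv ℝ f y u) (fderiv ℝ (fun y => fderiv ℝ f y u) x)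
        (x + (0 : ℝ) • u) := by
      rw [zero_smul, add_zero]
      exact (hd'.clm_apply (differentiableAt_const u)).hasFDerivAt
    rw [← fderiv_fderiv_apply_const hd']
    exact h2.comp_hasDerivAt 0 h1
  refine ge_of_tendsto hg.tendsto_slope_zero_right ?_
  have hmem : ∀ᶠ t in 𝓝 (0 : ℝ), x + t • u ∈ s :=
    h1.continuousAt.eventually_mem (hs.mem_nhds (by simpa using hx))
  filter_upwards [nhdsWithin_le_nhds hmem, self_mem_nhdsWithin] with t ht ht0
  have e1 := hf.add_fderiv_le hx ht ((hfx x hx).differentiableAt (by norm_num))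
  have e2 := hf.add_fderiv_le ht hx ((hfx _ ht).differentiableAt (by norm_num))
  simp only [add_sub_cancel_left, sub_add_cancel_left, map_neg, map_smul, smul_eq_mul] at e1 e2
  have ht0 : 0 < t := ht0
  simp only [zero_add, zero_smul, add_zero, smul_eq_mul]
  have : 0 ≤ t * (fderiv ℝ f (x + t • u) u - fderiv ℝ f x u) := by linarith
  exact mul_nonneg (inv_nonneg.2 ht0.le) (nonneg_of_mul_nonneg_right this ht0)

/-- A null direction of a positive semidefinite bilinear form lies in its kernel. -/
lemma apply_eq_zero_of_nonneg {B : E →L[ℝ] E →L[ℝ] ℝ} (hsymm : ∀ a b, B a b = B b a)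
    (hpos : ∀ a, 0 ≤ B a a) {v : E} (hv : B v v = 0) (a : E) : B v a = 0 := by
  have h : ∀ s : ℝ, 0 ≤ 2 * s * B v a + s ^ 2 * B a a := fun s => by
    have := hpos (v + s • a)
    simp only [map_add, map_smul, _root_.add_apply, _root_.smul_apply, smul_eq_mul, hv,
      hsymm a v] at this
    linarith
  have ha := hpos a
  have h1 := h (-(B v a) / (B a a + 1))
  have hp : 0 < B a a + 1 := by linarith
  have h2 : 2 * (-(B v a) / (B a a + 1)) * B v a + (-(B v a) / (B a a + 1)) ^ 2 * B a a =
      -(B v a) ^ 2 * (B a a + 2) / (B a a + 1) ^ 2 := by field_simp; ring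
  rw [h2, le_div_iff₀ (by positivity), zero_mul] at h1
  have h3 : (B v a) ^ 2 ≤ 0 := by nlinarith [sq_nonneg (B v a)]
  exact pow_eq_zero_iff (two_ne_zero) |>.1 (le_antisymm h3 (sq_nonneg _))

lemma norm_sub_sub_fderiv_le {s : Set E} (hs : Convex ℝ s) {f : E → F} {M : ℝ}
    (hf : ∀ y ∈ s, ContDiffAt ℝ 2 f y) (hM : ∀ y ∈ s, ‖fderiv ℝ (fderiv ℝ f) y‖ ≤ M)
    {x y : E} (hx : x ∈ s) (hy : y ∈ s) :
    ‖f y - f x - fderiv ℝ f x (y - x)‖ ≤ M * ‖y - x‖ ^ 2 := by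
  have hseg := hs.segment_subset hx hy
  have hM0 : 0 ≤ M := (norm_nonneg _).trans (hM x hx)
  have h := (convex_segment x y).norm_image_sub_le_of_norm_hasFDerivWithin_le'
    (f := f) (f' := fun z => fderiv ℝ f z) (φ := fderiv ℝ f x) (C := M * ‖y - x‖) (x := x) (y := y)
    (fun z hz => ((hf z (hseg hz)).differentiableAt (by norm_num)).hasFDerivAt.hasFDerivWithinAt)
    (fun z hz => ?_) (left_mem_segment ℝ x y) (right_mem_segment ℝ x y)
  · rw [pow_two, ← mul_assoc]
    exact h
  · refine (hs.norm_image_sub_le_of_norm_hasFDerivWithin_le (f := fderiv ℝ f)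
      (fun w hw => (hf w hw).differentiableAt_fderiv.hasFDerivAt.hasFDerivWithinAt)
      hM hx (hseg hz)).trans ?_
    gcongr
    obtain ⟨a, b, ha, hb, hab, rfl⟩ := hz
    have : a • x + b • y - x = b • (y - x) := by
      rw [← eq_sub_iff_add_eq] at hab
      rw [hab]; module
    rw [this, norm_smul, Real.norm_eq_abs, abs_of_nonneg hb]
    exact mul_le_of_le_one_left (norm_nonneg _) (by linarith)

/-- Glaeser's inequality, uniformly on compact sets. -/
lemma exists_norm_fderiv_sq_le [ProperSpace E] {U K : Set E} (hU : IsOpen U) (hK : IsCompact K)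
    (hKU : K ⊆ U) {g : E → ℝ} (hg : ContDiffOn ℝ 2 g U) (hg0 : ∀ x ∈ U, 0 ≤ g x) :
    ∃ C : ℝ, 0 ≤ C ∧ ∀ x ∈ K, ‖fderiv ℝ g x‖ ^ 2 ≤ C * g x := by
  obtain ⟨r, hr, hrU⟩ := hK.exists_cthickening_subset_open hU hKU
  have hgU : ∀ y ∈ U, ContDiffAt ℝ 2 g y := fun y hy => hg.contDiffAt (hU.mem_nhds hy)
  have hc1 : ContinuousOn (fderiv ℝ g) K := fun y hy =>
    (hgU y (hKU hy)).differentiableAt_fderiv.continuousAt.continuousWithinAt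
  have hc2 : ContinuousOn (fderiv ℝ (fderiv ℝ g)) (Metric.cthickening r K) := fun y hy =>
    (((hgU y (hrU hy)).fderiv_right (m := 1) (by norm_num)).fderiv_right (m := 0)
      (by norm_num)).continuousAt.continuousWithinAt
  obtain ⟨L, hL⟩ := hK.exists_bound_of_continuousOn hc1
  obtain ⟨M, hM⟩ := hK.cthickening.exists_bound_of_continuousOn hc2
  set τ : ℝ := min (r / (|L| + 1)) (1 / (2 * (|M| + 1))) with hτ
  have hτ0 : 0 < τ := by positivity
  have hτL : τ * (|L| + 1) ≤ r := by
    rw [← le_div_iff₀ (by positivity)]; exact min_le_left _ _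
  have hτM : τ * (2 * (|M| + 1)) ≤ 1 := by
    rw [← le_div_iff₀ (by positivity)]; exact min_le_right _ _
  refine ⟨2 / τ, by positivity, fun x hx => ?_⟩
  have hxU := hKU hx
  have key : ∀ u : E, ‖u‖ = 1 → (fderiv ℝ g x u) ^ 2 ≤ 2 / τ * g x := by
    intro u hu
    set a := fderiv ℝ g x u with ha
    have haL : |a| ≤ |L| := by
      have h1 : |a| ≤ ‖fderiv ℝ g x‖ * ‖u‖ := (fderiv ℝ g x).le_opNorm u
      rw [hu, mul_one] at h1
      exact h1.trans ((hL x hx).trans (le_abs_self L))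
    have hns : ‖(a * τ) • u‖ ≤ r := by
      rw [norm_smul, hu, mul_one, Real.norm_eq_abs, abs_mul, abs_of_pos hτ0]
      nlinarith [abs_nonneg a]
    have hsub : Metric.closedBall x r ⊆ Metric.cthickening r K :=
      Metric.closedBall_subset_cthickening hx r
    have hy : x - (a * τ) • u ∈ Metric.closedBall x r := by
      rw [Metric.mem_closedBall, dist_eq_norm, sub_sub_cancel_left, norm_neg]
      exact hns
    have h := norm_sub_sub_fderiv_le (convex_closedBall x r) (f := g) (M := |M| + 1)
      (fun y hy => hgU y (hrU (hsub hy)))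
      (fun y hy => (hM y (hsub hy)).trans ((le_abs_self M).trans (by linarith)))
      (Metric.mem_closedBall_self hr.le) hy
    have h0 := hg0 _ (hrU (hsub hy))
    rw [sub_sub_cancel_left, norm_neg, norm_smul, hu, mul_one, map_neg, map_smul, smul_eq_mul,
      ← ha, Real.norm_eq_abs, Real.norm_eq_abs, sq_abs] at h
    have h' := (abs_le.1 h).2
    rw [div_mul_eq_mul_div, le_div_iff₀ hτ0]
    have hq : (|M| + 1) * (a * τ) ^ 2 ≤ a ^ 2 * τ / 2 := by
      have : 0 ≤ a ^ 2 * τ := by positivity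
      nlinarith
    nlinarith
  have hgx := hg0 x hxU
  have hsq : ‖fderiv ℝ g x‖ ≤ Real.sqrt (2 / τ * g x) := by
    refine ContinuousLinearMap.opNorm_le_of_unit_norm (Real.sqrt_nonneg _) fun u hu => ?_
    rw [Real.norm_eq_abs]
    exact Real.abs_le_sqrt (key u hu)
  calc _ ≤ Real.sqrt (2 / τ * g x) ^ 2 := by gcongr
    _ = _ := Real.sq_sqrt (by positivity)

/-- Bounds on a function and on the oscillation of its second derivative control its derivatives
up to order two on a smaller ball. -/
lemma exists_fderiv_bounds_of_oscillation {r M Ω : ℝ} (hr : 0 < r) :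
    ∃ C : ℝ, ∀ (x₀ : E) (f : E → F), (∀ y ∈ Metric.ball x₀ (3 * r), ContDiffAt ℝ 2 f y) →
      (∀ y ∈ Metric.ball x₀ (3 * r), ‖f y‖ ≤ M) →
      (∀ y ∈ Metric.ball x₀ (3 * r), ∀ z ∈ Metric.ball x₀ (3 * r),
        ‖fderiv ℝ (fderiv ℝ f) y - fderiv ℝ (fderiv ℝ f) z‖ ≤ Ω) →
      ∀ y ∈ Metric.ball x₀ r, ‖fderiv ℝ f y‖ ≤ C ∧ ‖fderiv ℝ (fderiv ℝ f) y‖ ≤ C := by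
  set C₂ := |4 * M| / (r / 2) ^ 2 + |Ω| with hC₂
  have hC₂0 : 0 ≤ C₂ := by positivity
  refine ⟨max C₂ ((2 * |M| + (C₂ + |Ω|) * (r / 2) ^ 2) / (r / 2)), fun x₀ f hf hM hΩ => ?_⟩
  have hr2 : 0 < r / 2 := by positivity
  have hMM : ∀ y ∈ Metric.ball x₀ (3 * r), ‖f y‖ ≤ |M| := fun y hy => (hM y hy).trans (le_abs_self M)
  have hmem : ∀ {y : E} {a : ℝ}, y ∈ Metric.ball x₀ a → ∀ {h : E}, ‖h‖ ≤ r / 2 →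
      y + h ∈ Metric.ball x₀ (a + r) := by
    intro y a hy h hh
    rw [mem_ball_iff_norm] at hy ⊢
    calc ‖y + h - x₀‖ = ‖(y - x₀) + h‖ := by congr 1; abel
      _ ≤ ‖y - x₀‖ + ‖h‖ := norm_add_le _ _
      _ < a + r := by linarith
  have h12 : r + r ≤ 3 * r := by linarith
  have hns : ∀ {u : E}, ‖u‖ = 1 → ‖(r / 2) • u‖ = r / 2 := fun {u} hu => by
    rw [norm_smul, hu, mul_one, Real.norm_eq_abs, abs_of_pos hr2]
  have hd2 : ∀ y ∈ Metric.ball x₀ r, ‖fderiv ℝ (fderiv ℝ f) y‖ ≤ C₂ := by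
    intro y hy
    have hy3 : y ∈ Metric.ball x₀ (3 * r) := Metric.ball_subset_ball (by linarith) hy
    refine ContinuousLinearMap.opNorm_le_of_unit_norm hC₂0 fun u hu => ?_
    refine ContinuousLinearMap.opNorm_le_of_unit_norm hC₂0 fun w hw => ?_
    set k := (r / 2) • u with hk
    set h := (r / 2) • w with hh
    have hkn : ‖k‖ = r / 2 := hns hu
    have hhn : ‖h‖ = r / 2 := hns hw
    have hm3 : ∀ {z : E}, z ∈ Metric.ball x₀ (r + r) → z + k ∈ Metric.ball x₀ (3 * r) := by
      intro z hz
      have := hmem hz hkn.le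
      exact Metric.ball_subset_ball (by linarith) this
    have hm2 : ∀ {z : E}, z ∈ Metric.ball x₀ (r + r) → z ∈ Metric.ball x₀ (3 * r) :=
      fun hz => Metric.ball_subset_ball h12 hz
    have hd : ∀ z ∈ Metric.ball x₀ (r + r),
        ‖fderiv ℝ f (z + k) - fderiv ℝ f z - fderiv ℝ (fderiv ℝ f) y k‖ ≤ |Ω| * (r / 2) := by
      intro z hz
      have := (convex_ball x₀ (3 * r)).norm_image_sub_le_of_norm_hasFDerivWithin_le'
        (f := fderiv ℝ f) (f' := fderiv ℝ (fderiv ℝ f)) (φ := fderiv ℝ (fderiv ℝ f) y) (C := |Ω|)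
        (fun a ha => (hf a ha).differentiableAt_fderiv.hasFDerivAt.hasFDerivWithinAt)
        (fun a ha => (hΩ a ha y hy3).trans (le_abs_self Ω)) (hm2 hz) (hm3 hz)
      rwa [add_sub_cancel_left, hkn] at this
    have hy2 : y ∈ Metric.ball x₀ (r + r) := Metric.ball_subset_ball (by linarith) hy
    have hyh : y + h ∈ Metric.ball x₀ (r + r) := hmem hy hhn.le
    have key := (convex_ball x₀ (r + r)).norm_image_sub_le_of_norm_hasFDerivWithin_le'
      (f := fun z => f (z + k) - f z) (f' := fun z => fderiv ℝ f (z + k) - fderiv ℝ f z)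
      (φ := fderiv ℝ (fderiv ℝ f) y k) (C := |Ω| * (r / 2))
      (fun z hz => (((hasFDerivAt_comp_add_right k).2
        ((hf _ (hm3 hz)).differentiableAt (by norm_num)).hasFDerivAt).sub ((hf _ (hm2 hz)).differentiableAt (by norm_num)).hasFDerivAt).hasFDerivWithinAt)
      hd hy2 hyh
    rw [add_sub_cancel_left, hhn] at key
    have b1 := hMM _ (hm3 hyh)
    have b2 := hMM _ (hm2 hyh)
    have b3 := hMM _ (hm3 hy2)
    have b4 := hMM _ (hm2 hy2)
    have hval : fderiv ℝ (fderiv ℝ f) y k h = (r / 2) ^ 2 • fderiv ℝ (fderiv ℝ f) y u w := by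
      rw [hk, hh, map_smul, map_smul, _root_.smul_apply, smul_smul, pow_two]
    have hb : ‖fderiv ℝ (fderiv ℝ f) y k h‖ ≤ 4 * |M| + |Ω| * (r / 2) * (r / 2) := by
      have e : fderiv ℝ (fderiv ℝ f) y k h = (f (y + h + k) - f (y + h) - (f (y + k) - f y)) -
          (f (y + h + k) - f (y + h) - (f (y + k) - f y) - fderiv ℝ (fderiv ℝ f) y k h) := by abel
      rw [e]
      refine (norm_sub_le _ _).trans (add_le_add ?_ key)
      refine (norm_sub_le _ _).trans ?_
      linarith [norm_sub_le (f (y + h + k)) (f (y + h)), norm_sub_le (f (y + k)) (f y)]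
    rw [hval, norm_smul, norm_pow, Real.norm_eq_abs, abs_of_pos hr2] at hb
    rw [hC₂, abs_mul, abs_of_pos (zero_lt_four' ℝ), ← sub_le_iff_le_add, le_div_iff₀ (by positivity)]
    nlinarith
  have hC₁0 : 0 ≤ (2 * |M| + (C₂ + |Ω|) * (r / 2) ^ 2) / (r / 2) := by positivity
  have hx3 : x₀ ∈ Metric.ball x₀ (3 * r) := Metric.mem_ball_self (by linarith)
  have hd3 : ∀ y ∈ Metric.ball x₀ (3 * r), ‖fderiv ℝ (fderiv ℝ f) y‖ ≤ C₂ + |Ω| := by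
    intro y hy
    have h1 := hd2 x₀ (Metric.mem_ball_self hr)
    have h2 := (hΩ y hy x₀ hx3).trans (le_abs_self Ω)
    have h3 := norm_sub_norm_le (fderiv ℝ (fderiv ℝ f) y) (fderiv ℝ (fderiv ℝ f) x₀)
    linarith
  refine fun y hy => ⟨le_max_of_le_right ?_, le_max_of_le_left (hd2 y hy)⟩
  refine ContinuousLinearMap.opNorm_le_of_unit_norm hC₁0 fun u hu => ?_
  have hy3 : y ∈ Metric.ball x₀ (3 * r) := Metric.ball_subset_ball (by linarith) hy
  have hyu : y + (r / 2) • u ∈ Metric.ball x₀ (3 * r) :=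
    Metric.ball_subset_ball h12 (hmem hy (hns hu).le)
  have h := norm_sub_sub_fderiv_le (convex_ball x₀ (3 * r)) hf hd3 hy3 hyu
  rw [add_sub_cancel_left, hns hu, map_smul] at h
  have h' := norm_sub_norm_le ((r / 2) • fderiv ℝ f y u) (f (y + (r / 2) • u) - f y)
  rw [norm_sub_rev (_ • _), norm_smul, Real.norm_eq_abs, abs_of_pos hr2] at h'
  rw [le_div_iff₀ hr2]
  linarith [norm_sub_le (f (y + (r / 2) • u)) (f y), hMM _ hyu, hMM _ hy3]

end Taylor

section ParametricIntegral

set_option maxSynthPendingDepth 3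

variable {n : ℕ} {α : Type*} [MeasurableSpace α] {μ : Measure α}

lemma aestronglyMeasurable_fderiv_apply {U : Set (Fin n → ℝ)} (hU : IsOpen U)
    {G : (Fin n → ℝ) → α → ℝ} (hm : ∀ y ∈ U, AEStronglyMeasurable (G y) μ)
    {y : Fin n → ℝ} (hy : y ∈ U) (hd : ∀ᵐ z ∂μ, DifferentiableAt ℝ (fun u => G u z) y)
    (e : Fin n → ℝ) :
    AEStronglyMeasurable (fun z => fderiv ℝ (fun u => G u z) y e) μ := by
  classical
  have hc : Tendsto (fun t : ℝ => y + t • e) (𝓝[≠] 0) (𝓝 y) := by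
    have : Continuous fun t : ℝ => y + t • e := by fun_prop
    simpa using (this.tendsto 0).mono_left nhdsWithin_le_nhds
  have hev : ∀ᶠ t in 𝓝[≠] (0 : ℝ), y + t • e ∈ U := hc.eventually (hU.mem_nhds hy)
  refine aestronglyMeasurable_of_tendsto_ae (𝓝[≠] (0 : ℝ))
    (f := fun t z => if y + t • e ∈ U then t⁻¹ • (G (y + t • e) z - G y z) else 0) ?_ ?_
  · intro t
    by_cases h : y + t • e ∈ U
    · simp only [h, if_true]
      exact ((hm _ h).sub (hm _ hy)).const_smul t⁻¹
    · simp only [h, if_false]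
      exact aestronglyMeasurable_const
  · filter_upwards [hd] with z hz
    refine (hz.hasFDerivAt.hasLineDerivAt e).tendsto_slope_zero.congr' ?_
    filter_upwards [hev] with t ht
    simp only [ht, if_true]

lemma ContinuousLinearMap.eq_sum_smul_proj (L : (Fin n → ℝ) →L[ℝ] ℝ) :
    L = ∑ i, L (Pi.single i 1) • ContinuousLinearMap.proj (R := ℝ) (φ := fun _ : Fin n => ℝ) i := by
  ext x
  conv_lhs => rw [pi_eq_sum_univ' x, map_sum]
  simp [mul_comm]

lemma aestronglyMeasurable_fderiv {U : Set (Fin n → ℝ)} (hU : IsOpen U)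
    {G : (Fin n → ℝ) → α → ℝ} (hm : ∀ y ∈ U, AEStronglyMeasurable (G y) μ)
    {y : Fin n → ℝ} (hy : y ∈ U) (hd : ∀ᵐ z ∂μ, DifferentiableAt ℝ (fun u => G u z) y) :
    AEStronglyMeasurable (fun z => fderiv ℝ (fun u => G u z) y) μ := by
  have h : (fun z => fderiv ℝ (fun u => G u z) y) = fun z => ∑ i,
      fderiv ℝ (fun u => G u z) y (Pi.single i 1) •
        ContinuousLinearMap.proj (R := ℝ) (φ := fun _ : Fin n => ℝ) i :=
    funext fun z => ContinuousLinearMap.eq_sum_smul_proj _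
  rw [h]
  exact Finset.aestronglyMeasurable_fun_sum _ fun i _ =>
    (aestronglyMeasurable_fderiv_apply hU hm hy hd _).smul_const _

lemma hasFDerivAt_integral_of_bounded [IsFiniteMeasure μ] {U : Set (Fin n → ℝ)} (hU : IsOpen U)
    {G : (Fin n → ℝ) → α → ℝ} {C : ℝ} (hm : ∀ y ∈ U, AEStronglyMeasurable (G y) μ)
    (hd : ∀ᵐ z ∂μ, ∀ y ∈ U, DifferentiableAt ℝ (fun u => G u z) y)
    (h0 : ∀ᵐ z ∂μ, ∀ y ∈ U, ‖G y z‖ ≤ C)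
    (h1 : ∀ᵐ z ∂μ, ∀ y ∈ U, ‖fderiv ℝ (fun u => G u z) y‖ ≤ C) {y : Fin n → ℝ} (hy : y ∈ U) :
    Integrable (fun z => fderiv ℝ (fun u => G u z) y) μ ∧
      HasFDerivAt (fun u => ∫ z, G u z ∂μ) (∫ z, fderiv ℝ (fun u => G u z) y ∂μ) y := by
  have hm' := aestronglyMeasurable_fderiv hU hm hy (hd.mono fun z hz => hz y hy)
  refine ⟨(integrable_const C).mono' hm' (h1.mono fun z hz => hz y hy), ?_⟩
  exact hasFDerivAt_integral_of_dominated_of_fderiv_le (hU.mem_nhds hy)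
    (eventually_of_mem (hU.mem_nhds hy) hm)
    ((integrable_const C).mono' (hm y hy) (h0.mono fun z hz => hz y hy)) hm' h1
    (integrable_const C) (hd.mono fun z hz u hu => (hz u hu).hasFDerivAt)

lemma dir2_eq_fderiv_fderiv {f : (Fin n → ℝ) → ℝ} {x : Fin n → ℝ}
    (hf : DifferentiableAt ℝ (fderiv ℝ f) x) (v : Fin n → ℝ) :
    dir2 f x v = fderiv ℝ (fderiv ℝ f) x v v :=
  fderiv_fderiv_apply_const hf v v

lemma dir2_congr {f g : (Fin n → ℝ) → ℝ} {x : Fin n → ℝ} (h : f =ᶠ[𝓝 x] g) (v : Fin n → ℝ) :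
    dir2 f x v = dir2 g x v := by
  have : (fun y => fderiv ℝ f y v) =ᶠ[𝓝 x] fun y => fderiv ℝ g y v :=
    (h.fderiv (𝕜 := ℝ)).mono fun y hy => by simp only [hy]
  simp only [dir2, dmix, this.fderiv_eq]

lemma dir2_const_mul {f : (Fin n → ℝ) → ℝ} {x : Fin n → ℝ} (c : ℝ) (v : Fin n → ℝ) :
    dir2 (fun y => c * f y) x v = c * dir2 f x v := by
  simp only [dir2, dmix]
  have h : (fun y => fderiv ℝ (fun u => c * f u) y v) = fun y => c * fderiv ℝ f y v := by
    ext y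
    rw [show (fun u => c * f u) = c • f from rfl, fderiv_const_smul_field]
    simp
  rw [h, show (fun y => c * fderiv ℝ f y v) = c • fun y => fderiv ℝ f y v from rfl,
    fderiv_const_smul_field]
  simp

/-- Second directional derivatives commute with integration of uniformly `C²`-bounded families. -/
lemma dir2_integral_of_bounded [IsFiniteMeasure μ] {U : Set (Fin n → ℝ)} (hU : IsOpen U)
    {G : (Fin n → ℝ) → α → ℝ} {C : ℝ} (hm : ∀ y ∈ U, AEStronglyMeasurable (G y) μ)
    (hd : ∀ᵐ z ∂μ, ∀ y ∈ U, ContDiffAt ℝ 2 (fun u => G u z) y)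
    (h0 : ∀ᵐ z ∂μ, ∀ y ∈ U, ‖G y z‖ ≤ C)
    (h1 : ∀ᵐ z ∂μ, ∀ y ∈ U, ‖fderiv ℝ (fun u => G u z) y‖ ≤ C)
    (h2 : ∀ᵐ z ∂μ, ∀ y ∈ U, ‖fderiv ℝ (fderiv ℝ (fun u => G u z)) y‖ ≤ C)
    {x : Fin n → ℝ} (hx : x ∈ U) (v : Fin n → ℝ) :
    Integrable (fun z => dir2 (fun u => G u z) x v) μ ∧
      dir2 (fun u => ∫ z, G u z ∂μ) x v = ∫ z, dir2 (fun u => G u z) x v ∂μ := by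
  have hd1 : ∀ᵐ z ∂μ, ∀ y ∈ U, DifferentiableAt ℝ (fun u => G u z) y :=
    hd.mono fun z hz y hy => (hz y hy).differentiableAt (by norm_num)
  have hd2 : ∀ᵐ z ∂μ, ∀ y ∈ U, DifferentiableAt ℝ (fderiv ℝ (fun u => G u z)) y :=
    hd.mono fun z hz y hy => (hz y hy).differentiableAt_fderiv
  have hfirst := fun y (hy : y ∈ U) => hasFDerivAt_integral_of_bounded hU hm hd1 h0 h1 hy
  have hEq : (fun y => fderiv ℝ (fun u => ∫ z, G u z ∂μ) y v) =ᶠ[𝓝 x]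
      fun y => ∫ z, fderiv ℝ (fun u => G u z) y v ∂μ := by
    filter_upwards [hU.mem_nhds hx] with y hy
    rw [(hfirst y hy).2.fderiv, ContinuousLinearMap.integral_apply (hfirst y hy).1]
  have hsec := hasFDerivAt_integral_of_bounded (μ := μ) hU (C := |C| * ‖v‖)
    (G := fun y z => fderiv ℝ (fun u => G u z) y v)
    (fun y hy => aestronglyMeasurable_fderiv_apply hU hm hy (hd1.mono fun z hz => hz y hy) v)
    (hd2.mono fun z hz y hy => (hz y hy).clm_apply (differentiableAt_const v))
    (h1.mono fun z hz y hy => (ContinuousLinearMap.le_opNorm _ _).trans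
      (mul_le_mul_of_nonneg_right ((hz y hy).trans (le_abs_self C)) (norm_nonneg v)))
    (by
      filter_upwards [h2, hd2] with z hz hz' y hy
      refine ContinuousLinearMap.opNorm_le_bound _ (by positivity) fun a => ?_
      rw [fderiv_fderiv_apply_const (hz' y hy)]
      calc _ ≤ ‖fderiv ℝ (fderiv ℝ (fun u => G u z)) y‖ * ‖a‖ * ‖v‖ :=
            ContinuousLinearMap.le_opNorm₂ _ _ _
        _ ≤ |C| * ‖a‖ * ‖v‖ := by gcongr; exact (hz y hy).trans (le_abs_self C)
        _ = _ := by ring) hx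
  refine ⟨hsec.1.apply_continuousLinearMap v, ?_⟩
  simp only [dir2, dmix]
  rw [hEq.fderiv_eq, hsec.2.fderiv, ContinuousLinearMap.integral_apply hsec.1]

end ParametricIntegral

section JumpOperator

set_option maxSynthPendingDepth 3

variable {E F : Type*} [NormedAddCommGroup E] [NormedSpace ℝ E]
  [NormedAddCommGroup F] [NormedSpace ℝ F]

lemma isOpen_posOrth (n : ℕ) : IsOpen (posOrth n) := by
  simp only [posOrth, ofPred_forall]
  exact isOpen_iInter_of_finite fun i => isOpen_lt continuous_const (continuous_apply i)

lemma convex_posOrth (n : ℕ) : Convex ℝ (posOrth n) := by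
  intro x hx y hy a b ha hb hab i
  have h1 := hx i
  have h2 := hy i
  simp only [Pi.add_apply, Pi.smul_apply, smul_eq_mul]
  rcases ha.eq_or_lt with rfl | ha
  · rw [zero_add] at hab; subst hab; simpa using h2
  · have := mul_pos ha h1
    have := mul_nonneg hb h2.le
    linarith

lemma norm_fderiv_fderiv_sub_le_norm_iteratedFDeriv_sub (f : E → F) (y z : E) :
    ‖fderiv ℝ (fderiv ℝ f) y - fderiv ℝ (fderiv ℝ f) z‖ ≤
      ‖iteratedFDeriv ℝ 2 f y - iteratedFDeriv ℝ 2 f z‖ := by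
  refine ContinuousLinearMap.opNorm_le_bound₂ _ (norm_nonneg _) fun a b => ?_
  have h := (iteratedFDeriv ℝ 2 f y - iteratedFDeriv ℝ 2 f z).le_opNorm ![a, b]
  simpa [iteratedFDeriv_two_apply, Fin.prod_univ_two, mul_assoc] using h

lemma fderiv_fderiv_add {f g : E → F} {x : E} (hf : ContDiffAt ℝ 2 f x)
    (hg : ContDiffAt ℝ 2 g x) : fderiv ℝ (fderiv ℝ (fun y => f y + g y)) x =
      fderiv ℝ (fderiv ℝ f) x + fderiv ℝ (fderiv ℝ g) x := by
  have h : fderiv ℝ (fun y => f y + g y) =ᶠ[𝓝 x] fun y => fderiv ℝ f y + fderiv ℝ g y := by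
    filter_upwards [hf.eventually_contDiffAt_two, hg.eventually_contDiffAt_two] with y h1 h2
    exact fderiv_fun_add (h1.differentiableAt (by norm_num)) (h2.differentiableAt (by norm_num))
  rw [h.fderiv_eq, fderiv_fun_add hf.differentiableAt_fderiv hg.differentiableAt_fderiv]

lemma fderiv_fderiv_sub {f g : E → F} {x : E} (hf : ContDiffAt ℝ 2 f x)
    (hg : ContDiffAt ℝ 2 g x) : fderiv ℝ (fderiv ℝ (fun y => f y - g y)) x =
      fderiv ℝ (fderiv ℝ f) x - fderiv ℝ (fderiv ℝ g) x := by
  have h : fderiv ℝ (fun y => f y - g y) =ᶠ[𝓝 x] fun y => fderiv ℝ f y - fderiv ℝ g y := by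
    filter_upwards [hf.eventually_contDiffAt_two, hg.eventually_contDiffAt_two] with y h1 h2
    exact fderiv_fun_sub (h1.differentiableAt (by norm_num)) (h2.differentiableAt (by norm_num))
  rw [h.fderiv_eq, fderiv_fun_sub hf.differentiableAt_fderiv hg.differentiableAt_fderiv]

variable {n : ℕ} {T : ℝ} {x : Fin n → ℝ} {t : ℝ}

lemma dir2_sub {f g : (Fin n → ℝ) → ℝ} (hf : ContDiffAt ℝ 2 f x)
    (hg : ContDiffAt ℝ 2 g x) (v : Fin n → ℝ) :
    dir2 (fun y => f y - g y) x v = dir2 f x v - dir2 g x v := by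
  rw [dir2_eq_fderiv_fderiv (hf.sub hg).differentiableAt_fderiv,
    dir2_eq_fderiv_fderiv hf.differentiableAt_fderiv,
    dir2_eq_fderiv_fderiv hg.differentiableAt_fderiv, fderiv_fderiv_sub hf hg]
  rfl

lemma Icc_subset_posOrth {a b : Fin n → ℝ} (ha : a ∈ posOrth n) :
    Icc a b ⊆ posOrth n := fun _ hy i => (ha i).trans_le (hy.1 i)

namespace JumpKernel

lemma contDiffAt (K : JumpKernel n T) (ht : t ∈ Icc 0 T) {z : ℝ} (hz : z ∈ Icc (0 : ℝ) 1)
    (hx : x ∈ posOrth n) : ContDiffAt ℝ 2 (fun y => K.φ y t z) x :=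
  (K.smooth t ht z hz).contDiffAt ((isOpen_posOrth n).mem_nhds hx)

lemma add_mem_posOrth (K : JumpKernel n T) (ht : t ∈ Icc 0 T) {z : ℝ} (hz : z ∈ Icc (0 : ℝ) 1)
    (hx : x ∈ posOrth n) : x + K.φ x t z ∈ posOrth n := fun i => by
  obtain ⟨γ, hγ, h⟩ := K.lower
  have h1 := h x hx t ht z hz i
  have h2 := hx i
  simp only [Pi.add_apply]
  nlinarith

/-- Near a point of the orthant, all jumps stay in a common compact box. -/
lemma exists_box (K : JumpKernel n T) (ht : t ∈ Icc 0 T) (hx : x ∈ posOrth n) :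
    ∃ a ∈ posOrth n, ∃ b : Fin n → ℝ, ∀ᶠ y in 𝓝 x, y ∈ Icc a b ∧
      ∀ z ∈ Icc (0 : ℝ) 1, y + K.φ y t z ∈ Icc a b := by
  obtain ⟨γ, hγ, hlow⟩ := K.lower
  obtain ⟨D, hD, hbd⟩ := K.bound
  have hm : 0 < min 1 (1 + γ) := lt_min one_pos (by linarith)
  refine ⟨fun i => min 1 (1 + γ) * (x i / 2), fun i => mul_pos hm (half_pos (hx i)),
    fun i => (1 + √D) * (2 * x i), ?_⟩
  have hU : ∀ᶠ y in 𝓝 x, ∀ i, x i / 2 < y i ∧ y i < 2 * x i := by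
    refine eventually_all.2 fun i => ?_
    have hc : Tendsto (fun y : Fin n → ℝ => y i) (𝓝 x) (𝓝 (x i)) :=
      (continuous_apply i).continuousAt
    exact (hc.eventually (lt_mem_nhds (half_lt_self (hx i)))).and
      (hc.eventually (gt_mem_nhds (by linarith [hx i])))
  filter_upwards [hU, (isOpen_posOrth n).mem_nhds hx] with y hy hyp
  have hle : ∀ i, min 1 (1 + γ) * (x i / 2) ≤ y i := fun i => by
    nlinarith [min_le_left 1 (1 + γ), hx i, (hy i).1]
  have hS := Real.sqrt_nonneg D
  refine ⟨⟨hle, fun i => ?_⟩, fun z hz => ⟨fun i => ?_, fun i => ?_⟩⟩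
  · simp only
    nlinarith [(hy i).2, hx i, mul_nonneg hS (hx i).le]
  · have h1 := hlow y hyp t ht z hz i
    simp only [Pi.add_apply]
    have h2 : min 1 (1 + γ) * (x i / 2) ≤ (1 + γ) * (x i / 2) :=
      mul_le_mul_of_nonneg_right (min_le_right _ _) (half_pos (hx i)).le
    have h3 : (1 + γ) * (x i / 2) ≤ (1 + γ) * y i :=
      mul_le_mul_of_nonneg_left (hy i).1.le (by linarith)
    linarith
  · have h1 := Real.abs_le_sqrt (hbd y hyp t ht z hz i)
    rw [Real.sqrt_mul hD.le, Real.sqrt_sq (hyp i).le] at h1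
    have h2 := (abs_le.1 h1).2
    simp only [Pi.add_apply]
    nlinarith [(hy i).2, mul_le_mul_of_nonneg_left (hy i).2.le hS]

/-- Local `C²` bounds for the jump kernel, uniform in the mark. -/
lemma exists_local_bounds (K : JumpKernel n T) (ht : t ∈ Icc 0 T) (hx : x ∈ posOrth n) :
    ∃ C : ℝ, 0 ≤ C ∧ ∀ᶠ y in 𝓝 x, ∀ z ∈ Icc (0 : ℝ) 1, ‖K.φ y t z‖ ≤ C ∧
      ‖fderiv ℝ (fun u => K.φ u t z) y‖ ≤ C ∧
      ‖fderiv ℝ (fderiv ℝ fun u => K.φ u t z) y‖ ≤ C := by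
  obtain ⟨D, hD, hbd⟩ := K.bound
  obtain ⟨α, hα, -, hhol⟩ := K.holder2
  obtain ⟨s, hs, hsU, A, hA⟩ := hhol t ht x hx
  obtain ⟨ρ, hρ, hρs⟩ := Metric.mem_nhds_iff.1 hs
  have hr : 0 < ρ / 3 := by positivity
  have hball : Metric.ball x (3 * (ρ / 3)) ⊆ s := by
    rwa [mul_div_cancel₀ _ (by norm_num : (3 : ℝ) ≠ 0)]
  have hM : ∀ z ∈ Icc (0 : ℝ) 1, ∀ y ∈ Metric.ball x (3 * (ρ / 3)),
      ‖K.φ y t z‖ ≤ √D * (‖x‖ + 3 * (ρ / 3)) := by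
    intro z hz y hy
    refine (pi_norm_le_iff_of_nonneg (by positivity)).2 fun i => ?_
    have hyp := hsU (hball hy)
    have h1 := Real.abs_le_sqrt (hbd y hyp t ht z hz i)
    rw [Real.sqrt_mul hD.le, Real.sqrt_sq (hyp i).le] at h1
    refine h1.trans (mul_le_mul_of_nonneg_left ?_ (Real.sqrt_nonneg D))
    have h2 := (le_abs_self (y i)).trans (norm_le_pi_norm y i)
    have h3 := norm_sub_norm_le y x
    rw [mem_ball_iff_norm] at hy
    linarith
  obtain ⟨C, hC⟩ := exists_fderiv_bounds_of_oscillation (E := Fin n → ℝ) (F := Fin n → ℝ) hr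
    (M := √D * (‖x‖ + 3 * (ρ / 3))) (Ω := A * (2 * (3 * (ρ / 3))) ^ (α : ℝ))
  refine ⟨max C (√D * (‖x‖ + 3 * (ρ / 3))), le_max_of_le_right (by positivity), ?_⟩
  filter_upwards [Metric.ball_mem_nhds x hr] with y hy z hz
  have hy3 : y ∈ Metric.ball x (3 * (ρ / 3)) := Metric.ball_subset_ball (by linarith) hy
  have h := hC x (fun u => K.φ u t z) (fun u hu => K.contDiffAt ht hz (hsU (hball hu)))
    (hM z hz) ?_ y hy
  · exact ⟨le_max_of_le_right (hM z hz y hy3), le_max_of_le_left h.1, le_max_of_le_left h.2⟩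
  intro u hu w hw
  refine (norm_fderiv_fderiv_sub_le_norm_iteratedFDeriv_sub _ _ _).trans ?_
  rw [← dist_eq_norm]
  refine (HolderOnWith.dist_le_of_le (hA z hz) (hball hu) (hball hw) ?_)
  rw [Metric.mem_ball] at hu hw
  linarith [dist_triangle_right u w x]

end JumpKernel

end JumpOperator

section JumpIntegrand

set_option maxSynthPendingDepth 3

/-- The compensated increment of `w` along the displacement field `φ`. -/
def jumpIncrement {E : Type*} [NormedAddCommGroup E] [NormedSpace ℝ E] (φ : E → E) (w : E → ℝ)
    (y : E) : ℝ :=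
  w (y + φ y) - w y - fderiv ℝ w y (φ y)

section

variable {E : Type*} [NormedAddCommGroup E] [NormedSpace ℝ E] {φ : E → E} {w : E → ℝ} {x : E}

lemma norm_fderiv_id_add_le {C : ℝ} (hφ : DifferentiableAt ℝ φ x) (h : ‖fderiv ℝ φ x‖ ≤ C) :
    ‖fderiv ℝ (fun y => y + φ y) x‖ ≤ 1 + C := by
  rw [fderiv_fun_add differentiableAt_fun_id hφ, fderiv_fun_id]
  exact (norm_add_le _ _).trans (add_le_add ContinuousLinearMap.norm_id_le h)

lemma fderiv_fderiv_id_add (hφ : ContDiffAt ℝ 2 φ x) :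
    fderiv ℝ (fderiv ℝ (fun y => y + φ y)) x = fderiv ℝ (fderiv ℝ φ) x := by
  rw [fderiv_fderiv_add (f := fun y => y) contDiffAt_id hφ]
  have : fderiv ℝ (fun y : E => y) = fun _ => ContinuousLinearMap.id ℝ E :=
    funext fun _ => fderiv_fun_id
  rw [this]
  simp

lemma contDiffAt_apply_fderiv (hw : ContDiffAt ℝ 3 w x) (hφ : ContDiffAt ℝ 2 φ x) :
    ContDiffAt ℝ 2 (fun y => fderiv ℝ w y (φ y)) x :=
  (hw.fderiv_right (m := 2) (by norm_num)).clm_apply hφ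

lemma contDiffAt_comp_id_add (hw : ContDiffAt ℝ 2 w (x + φ x)) (hφ : ContDiffAt ℝ 2 φ x) :
    ContDiffAt ℝ 2 (fun y => w (y + φ y)) x :=
  hw.comp x (contDiffAt_id.add hφ)

lemma contDiffAt_jumpIncrement (hw : ContDiffAt ℝ 3 w x) (hw' : ContDiffAt ℝ 2 w (x + φ x))
    (hφ : ContDiffAt ℝ 2 φ x) : ContDiffAt ℝ 2 (jumpIncrement φ w) x :=
  ((contDiffAt_comp_id_add hw' hφ).sub (hw.of_le (by norm_num))).sub
    (contDiffAt_apply_fderiv hw hφ)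

lemma norm_jumpIncrement_le {N C : ℝ} (hw : ContDiffAt ℝ 3 w x)
    (hw' : ContDiffAt ℝ 2 w (x + φ x)) (hφ : ContDiffAt ℝ 2 φ x)
    (h0 : |w x| ≤ N) (h1 : ‖fderiv ℝ w x‖ ≤ N) (h2 : ‖fderiv ℝ (fderiv ℝ w) x‖ ≤ N)
    (h3 : ‖fderiv ℝ (fderiv ℝ (fderiv ℝ w)) x‖ ≤ N) (h0' : |w (x + φ x)| ≤ N)
    (h1' : ‖fderiv ℝ w (x + φ x)‖ ≤ N) (h2' : ‖fderiv ℝ (fderiv ℝ w) (x + φ x)‖ ≤ N)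
    (c0 : ‖φ x‖ ≤ C) (c1 : ‖fderiv ℝ φ x‖ ≤ C) (c2 : ‖fderiv ℝ (fderiv ℝ φ) x‖ ≤ C) :
    ‖jumpIncrement φ w x‖ ≤ 6 * (N * (1 + C) ^ 2) ∧
      ‖fderiv ℝ (jumpIncrement φ w) x‖ ≤ 6 * (N * (1 + C) ^ 2) ∧
      ‖fderiv ℝ (fderiv ℝ (jumpIncrement φ w)) x‖ ≤ 6 * (N * (1 + C) ^ 2) := by
  have hN : 0 ≤ N := (abs_nonneg _).trans h0
  have hC : 0 ≤ C := (norm_nonneg _).trans c0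
  have hNC : 0 ≤ N * C := mul_nonneg hN hC
  have hNCC : 0 ≤ N * C * C := mul_nonneg hNC hC
  have hexp : 6 * (N * (1 + C) ^ 2) = 6 * N + 12 * (N * C) + 6 * (N * C * C) := by ring
  have hw2 : ContDiffAt ℝ 2 w x := hw.of_le (by norm_num)
  have hL : ContDiffAt ℝ 2 (fderiv ℝ w) x := hw.fderiv_right (by norm_num)
  have hA := contDiffAt_comp_id_add hw' hφ
  have hB := contDiffAt_apply_fderiv hw hφ
  have hΦ : ContDiffAt ℝ 2 (fun y => y + φ y) x := contDiffAt_id.add hφ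
  have hΦ1 := norm_fderiv_id_add_le (hφ.differentiableAt (by norm_num)) c1
  rw [hexp]
  refine ⟨?_, ?_, ?_⟩
  · have e : ‖fderiv ℝ w x (φ x)‖ ≤ N * C :=
      ((fderiv ℝ w x).le_opNorm _).trans (mul_le_mul h1 c0 (norm_nonneg _) hN)
    have e1 := norm_sub_le (w (x + φ x) - w x) (fderiv ℝ w x (φ x))
    have e2 := norm_sub_le (w (x + φ x)) (w x)
    rw [Real.norm_eq_abs (w (x + φ x)), Real.norm_eq_abs (w x)] at e2
    simp only [jumpIncrement]
    linarith
  · have d1 : fderiv ℝ (jumpIncrement φ w) x = fderiv ℝ (fun y => w (y + φ y)) x - fderiv ℝ w x -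
        fderiv ℝ (fun y => fderiv ℝ w y (φ y)) x := by
      unfold jumpIncrement
      rw [fderiv_fun_sub ((hA.sub hw2).differentiableAt (by norm_num))
        (hB.differentiableAt (by norm_num)), fderiv_fun_sub (hA.differentiableAt (by norm_num))
        (hw2.differentiableAt (by norm_num))]
    rw [d1]
    have e1 : ‖fderiv ℝ (fun y => w (y + φ y)) x‖ ≤ N * (1 + C) :=
      (norm_fderiv_comp_le (w := w) (Φ := fun y => y + φ y) (hw'.differentiableAt (by norm_num))
        (hΦ.differentiableAt (by norm_num))).trans (mul_le_mul h1' hΦ1 (norm_nonneg _) hN)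
    have e2 : ‖fderiv ℝ (fun y => fderiv ℝ w y (φ y)) x‖ ≤ N * C + N * C :=
      (norm_fderiv_clm_apply_le (hL.differentiableAt (by norm_num))
        (hφ.differentiableAt (by norm_num))).trans
        (add_le_add (mul_le_mul h1 c1 (norm_nonneg _) hN) (mul_le_mul h2 c0 (norm_nonneg _) hN))
    have e3 := norm_sub_le (fderiv ℝ (fun y => w (y + φ y)) x - fderiv ℝ w x)
      (fderiv ℝ (fun y => fderiv ℝ w y (φ y)) x)
    have e4 := norm_sub_le (fderiv ℝ (fun y => w (y + φ y)) x) (fderiv ℝ w x)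
    linarith
  · have d2 : fderiv ℝ (fderiv ℝ (jumpIncrement φ w)) x =
        fderiv ℝ (fderiv ℝ (fun y => w (y + φ y))) x - fderiv ℝ (fderiv ℝ w) x -
        fderiv ℝ (fderiv ℝ (fun y => fderiv ℝ w y (φ y))) x := by
      unfold jumpIncrement
      rw [fderiv_fderiv_sub (hA.sub hw2) hB, fderiv_fderiv_sub hA hw2]
    rw [d2]
    have e1 : ‖fderiv ℝ (fderiv ℝ (fun y => w (y + φ y))) x‖ ≤ N * (1 + C) ^ 2 + N * C := by
      refine (norm_fderiv_fderiv_comp_le (w := w) (Φ := fun y => y + φ y) hw' hΦ).trans ?_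
      rw [fderiv_fderiv_id_add hφ]
      gcongr
    have e2 : ‖fderiv ℝ (fderiv ℝ (fun y => fderiv ℝ w y (φ y))) x‖ ≤
        N * C + 2 * (N * C) + N * C := by
      refine (norm_fderiv_fderiv_clm_apply_le hL hφ).trans ?_
      gcongr
    have e3 := norm_sub_le (fderiv ℝ (fderiv ℝ (fun y => w (y + φ y))) x - fderiv ℝ (fderiv ℝ w) x)
      (fderiv ℝ (fderiv ℝ (fun y => fderiv ℝ w y (φ y))) x)
    have e4 := norm_sub_le (fderiv ℝ (fderiv ℝ (fun y => w (y + φ y))) x)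
      (fderiv ℝ (fderiv ℝ w) x)
    linarith

end

variable {n : ℕ} {T : ℝ} {x : Fin n → ℝ} {t : ℝ} {w : (Fin n → ℝ) → ℝ}

lemma JumpKernel.aestronglyMeasurable_jumpIncrement (K : JumpKernel n T) (ht : t ∈ Icc 0 T)
    (hx : x ∈ posOrth n) (hw : ContinuousOn w (posOrth n)) :
    AEStronglyMeasurable (fun z => jumpIncrement (fun y => K.φ y t z) w x)
      (volume.restrict (Icc (0 : ℝ) 1)) := by
  have hm := K.meas x hx t ht
  have h1 : AEStronglyMeasurable (fun z => w (x + K.φ x t z)) (volume.restrict (Icc (0 : ℝ) 1)) := by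
    have hind : Measurable ((posOrth n).indicator w) := by
      classical
      rw [← Set.piecewise_eq_indicator]
      exact hw.measurable_piecewise continuousOn_const (isOpen_posOrth n).measurableSet
    refine ((hind.comp (hm.const_add x)).aestronglyMeasurable).congr ?_
    filter_upwards [ae_restrict_mem measurableSet_Icc] with z hz
    exact indicator_of_mem (K.add_mem_posOrth ht hz hx) w
  exact (h1.sub aestronglyMeasurable_const).sub
    ((fderiv ℝ w x).measurable.comp hm).aestronglyMeasurable

/-- The second directional derivative of `B w` is computed under the integral sign. -/
lemma JumpKernel.dir2_Bop (K : JumpKernel n T) (ht : t ∈ Icc 0 T) (hx : x ∈ posOrth n)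
    (hw : ContDiffOn ℝ 4 w (posOrth n)) (lam : ℝ → ℝ) (v : Fin n → ℝ) :
    IntegrableOn (fun z => dir2 (jumpIncrement (fun y => K.φ y t z) w) x v) (Icc (0 : ℝ) 1) ∧
      dir2 (fun y => Bop lam K w y t) x v =
        lam t * ∫ z in Icc (0 : ℝ) 1, dir2 (jumpIncrement (fun y => K.φ y t z) w) x v := by
  have hwx : ∀ y ∈ posOrth n, ContDiffAt ℝ 4 w y := fun y hy =>
    hw.contDiffAt ((isOpen_posOrth n).mem_nhds hy)
  obtain ⟨a, ha, b, hab⟩ := K.exists_box ht hx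
  obtain ⟨C, hC0, hC⟩ := K.exists_local_bounds ht hx
  have hsub := Icc_subset_posOrth (b := b) ha
  have hc1 : ∀ y ∈ Icc a b, ContDiffAt ℝ 3 (fderiv ℝ w) y := fun y hy =>
    (hwx y (hsub hy)).fderiv_right (by norm_num)
  have hc2 : ∀ y ∈ Icc a b, ContDiffAt ℝ 2 (fderiv ℝ (fderiv ℝ w)) y := fun y hy =>
    (hc1 y hy).fderiv_right (by norm_num)
  have hc3 : ∀ y ∈ Icc a b, ContDiffAt ℝ 1 (fderiv ℝ (fderiv ℝ (fderiv ℝ w))) y := fun y hy =>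
    (hc2 y hy).fderiv_right (by norm_num)
  have hcpt : IsCompact (Icc a b) := isCompact_Icc
  obtain ⟨N0, hN0⟩ := hcpt.exists_bound_of_continuousOn
    (fun y hy => (hwx y (hsub hy)).continuousAt.continuousWithinAt)
  obtain ⟨N1, hN1⟩ := hcpt.exists_bound_of_continuousOn
    (fun y hy => (hc1 y hy).continuousAt.continuousWithinAt)
  obtain ⟨N2, hN2⟩ := hcpt.exists_bound_of_continuousOn
    (fun y hy => (hc2 y hy).continuousAt.continuousWithinAt)
  obtain ⟨N3, hN3⟩ := hcpt.exists_bound_of_continuousOn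
    (fun y hy => (hc3 y hy).continuousAt.continuousWithinAt)
  set N := max (max N0 N1) (max N2 N3) with hN
  have l0 : N0 ≤ N := (le_max_left _ _).trans (le_max_left _ _)
  have l1 : N1 ≤ N := (le_max_right _ _).trans (le_max_left _ _)
  have l2 : N2 ≤ N := (le_max_left _ _).trans (le_max_right _ _)
  have l3 : N3 ≤ N := (le_max_right _ _).trans (le_max_right _ _)
  obtain ⟨U, hU, hUo, hxU⟩ := eventually_nhds_iff.1
    ((hab.and hC).and ((isOpen_posOrth n).mem_nhds hx))
  have hbd : ∀ z ∈ Icc (0 : ℝ) 1, ∀ y ∈ U,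
      ContDiffAt ℝ 2 (jumpIncrement (fun y => K.φ y t z) w) y ∧
      ‖jumpIncrement (fun y => K.φ y t z) w y‖ ≤ 6 * (N * (1 + C) ^ 2) ∧
      ‖fderiv ℝ (jumpIncrement (fun y => K.φ y t z) w) y‖ ≤ 6 * (N * (1 + C) ^ 2) ∧
      ‖fderiv ℝ (fderiv ℝ (jumpIncrement (fun y => K.φ y t z) w)) y‖ ≤ 6 * (N * (1 + C) ^ 2) := by
    intro z hz y hy
    obtain ⟨⟨⟨hyI, hyz⟩, hyC⟩, hyp⟩ := hU y hy
    obtain ⟨c0, c1, c2⟩ := hyC z hz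
    have hyz := hyz z hz
    have g1 : ContDiffAt ℝ 3 w y := (hwx y hyp).of_le (by norm_num)
    have g2 : ContDiffAt ℝ 2 w (y + K.φ y t z) := (hwx _ (hsub hyz)).of_le (by norm_num)
    exact ⟨contDiffAt_jumpIncrement g1 g2 (K.contDiffAt ht hz hyp),
      norm_jumpIncrement_le g1 g2 (K.contDiffAt ht hz hyp) ((hN0 y hyI).trans l0)
      ((hN1 y hyI).trans l1) ((hN2 y hyI).trans l2) ((hN3 y hyI).trans l3)
      ((hN0 _ hyz).trans l0) ((hN1 _ hyz).trans l1) ((hN2 _ hyz).trans l2) c0 c1 c2⟩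
  have hae : ∀ {p : ℝ → Prop}, (∀ z ∈ Icc (0 : ℝ) 1, p z) →
      ∀ᵐ z ∂(volume.restrict (Icc (0 : ℝ) 1)), p z := fun h =>
    (ae_restrict_mem measurableSet_Icc).mono h
  have h := dir2_integral_of_bounded (μ := volume.restrict (Icc (0 : ℝ) 1)) hUo
    (G := fun y z => jumpIncrement (fun y => K.φ y t z) w y) (C := 6 * (N * (1 + C) ^ 2))
    (fun y hy => K.aestronglyMeasurable_jumpIncrement ht (hU y hy).2 hw.continuousOn)
    (hae fun z hz y hy => (hbd z hz y hy).1) (hae fun z hz y hy => (hbd z hz y hy).2.1)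
    (hae fun z hz y hy => (hbd z hz y hy).2.2.1) (hae fun z hz y hy => (hbd z hz y hy).2.2.2)
    hxU v
  refine ⟨h.1, ?_⟩
  rw [← h.2]
  exact dir2_const_mul _ _

end JumpIntegrand

section Flattening

set_option maxSynthPendingDepth 3

lemma fderiv_fderiv_const_mul {E : Type*} [NormedAddCommGroup E] [NormedSpace ℝ E] {f : E → ℝ}
    (c : ℝ) (x : E) : fderiv ℝ (fun y => c * f y) x = c • fderiv ℝ f x ∧
      fderiv ℝ (fderiv ℝ fun y => c * f y) x = c • fderiv ℝ (fderiv ℝ f) x := by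
  have h : fderiv ℝ (fun y => c * f y) = c • fderiv ℝ f := by
    ext1 y
    exact congrFun (fderiv_const_smul_field (f := f) c) y
  refine ⟨congrFun h x, ?_⟩
  rw [h, fderiv_const_smul_field]
  rfl

/-- The error of the first order Taylor approximation of `f` at `x₀`. -/
def tangentGap {E : Type*} [NormedAddCommGroup E] [NormedSpace ℝ E] (f : E → ℝ) (x₀ y : E) : ℝ :=
  f y - f x₀ - fderiv ℝ f x₀ (y - x₀)

/-- Modification of `f` which agrees with its tangent plane where the gap is at most `δ`, if `θ` is
the truncation at level `δ`. -/
def flattened {E : Type*} [NormedAddCommGroup E] [NormedSpace ℝ E] (θ : ℝ → ℝ) (f : E → ℝ)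
    (x₀ y : E) : ℝ :=
  f y - θ (tangentGap f x₀ y)

section

variable {E : Type*} [NormedAddCommGroup E] [NormedSpace ℝ E] {f : E → ℝ} {x₀ x : E}

lemma tangentGap_self : tangentGap f x₀ x₀ = 0 := by simp [tangentGap]

lemma tangentGap_add_const_mul {g : E → ℝ} (c : ℝ) (hf : DifferentiableAt ℝ f x₀)
    (hg : DifferentiableAt ℝ g x₀) (y : E) :
    tangentGap (fun u => f u + c * g u) x₀ y = tangentGap f x₀ y + c * tangentGap g x₀ y := by
  simp only [tangentGap]
  rw [fderiv_fun_add hf (hg.const_mul c), (fderiv_fderiv_const_mul c x₀).1]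
  simp only [_root_.add_apply, _root_.smul_apply, smul_eq_mul]
  ring

lemma ConvexOn.tangentGap_nonneg {s : Set E} (hf : ConvexOn ℝ s f) (hx₀ : x₀ ∈ s) (hx : x ∈ s)
    (hd : DifferentiableAt ℝ f x₀) : 0 ≤ tangentGap f x₀ x := by
  have := hf.add_fderiv_le hx₀ hx hd
  simp only [tangentGap]
  linarith

lemma contDiffAt_tangentGap {k : ℕ} (hf : ContDiffAt ℝ k f x) :
    ContDiffAt ℝ k (tangentGap f x₀) x :=
  (hf.sub contDiffAt_const).sub
    ((fderiv ℝ f x₀).contDiff.contDiffAt.comp x (contDiffAt_id.sub contDiffAt_const))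

lemma fderiv_tangentGap (hf : DifferentiableAt ℝ f x) :
    fderiv ℝ (tangentGap f x₀) x = fderiv ℝ f x - fderiv ℝ f x₀ := by
  have h : HasFDerivAt (fun y => fderiv ℝ f x₀ (y - x₀)) (fderiv ℝ f x₀) x :=
    (fderiv ℝ f x₀).hasFDerivAt.comp x ((hasFDerivAt_id x).sub_const x₀)
  exact ((hf.hasFDerivAt.sub_const _).sub h).fderiv

lemma fderiv_fderiv_tangentGap (hf : ContDiffAt ℝ 2 f x) :
    fderiv ℝ (fderiv ℝ (tangentGap f x₀)) x = fderiv ℝ (fderiv ℝ f) x := by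
  have h : fderiv ℝ (tangentGap f x₀) =ᶠ[𝓝 x] fun y => fderiv ℝ f y - fderiv ℝ f x₀ := by
    filter_upwards [hf.eventually_contDiffAt_two] with y hy
    exact fderiv_tangentGap (hy.differentiableAt (by norm_num))
  rw [h.fderiv_eq, fderiv_sub_const]

lemma flattened_eventuallyEq {C δ : ℝ} {θ : ℝ → ℝ} (hδ : 0 < δ) (hθ : IsTruncation C δ θ)
    (hf : ContDiffAt ℝ 2 f x₀) :
    flattened θ f x₀ =ᶠ[𝓝 x₀] fun y => f x₀ + fderiv ℝ f x₀ (y - x₀) := by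
  have hc : ContinuousAt (tangentGap f x₀) x₀ := (contDiffAt_tangentGap (k := 2) hf).continuousAt
  have : ∀ᶠ y in 𝓝 x₀, tangentGap f x₀ y < δ :=
    hc.eventually (gt_mem_nhds (by rwa [tangentGap_self]))
  filter_upwards [this] with y hy
  rw [flattened, hθ.eq_self _ hy.le, tangentGap]
  ring

lemma convexOn_flattened {C δ : ℝ} {θ : ℝ → ℝ} (hθ : IsTruncation C δ θ) {s : Set E}
    (hf : ConvexOn ℝ s f) : ConvexOn ℝ s (flattened θ f x₀) := by
  have haff : ∀ (c : ℝ) (L : E →L[ℝ] ℝ), ConvexOn ℝ s fun y => c + L y := fun c L => by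
    refine ⟨hf.1, fun x _ y _ a b _ _ hab => le_of_eq ?_⟩
    simp only [map_add, map_smul, smul_eq_mul]
    linear_combination (-c) * hab
  have hgap : ConvexOn ℝ s (tangentGap f x₀) := by
    refine (hf.add (haff (-f x₀ + fderiv ℝ f x₀ x₀) (-fderiv ℝ f x₀))).congr fun y _ => ?_
    simp only [tangentGap, Pi.add_apply, map_sub, _root_.neg_apply]
    ring
  have hψ : ConvexOn ℝ s fun y => tangentGap f x₀ y - θ (tangentGap f x₀ y) := by
    refine ⟨hf.1, fun x hx y hy a b ha hb hab => ?_⟩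
    exact (hθ.mono (hgap.2 hx hy ha hb hab)).trans
      (hθ.convex.2 (mem_univ _) (mem_univ _) ha hb hab)
  refine (hψ.add (haff (f x₀ - fderiv ℝ f x₀ x₀) (fderiv ℝ f x₀))).congr fun y _ => ?_
  simp only [flattened, tangentGap, Pi.add_apply, map_sub]
  ring

lemma norm_fderiv_real (θ : ℝ → ℝ) (s : ℝ) : ‖fderiv ℝ θ s‖ = |deriv θ s| := by
  rw [← norm_deriv_eq_norm_fderiv, Real.norm_eq_abs]

lemma norm_fderiv_fderiv_real {θ : ℝ → ℝ} (s : ℝ) :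
    ‖fderiv ℝ (fderiv ℝ θ) s‖ = |deriv (deriv θ) s| := by
  rw [← norm_iteratedFDeriv_one, norm_iteratedFDeriv_fderiv, norm_iteratedFDeriv_eq_norm_iteratedDeriv,
    show (1 + 1) = 2 from rfl, iteratedDeriv_succ, iteratedDeriv_one, Real.norm_eq_abs]

lemma IsTruncation.norm_fderiv_comp_le {C δ : ℝ} {θ : ℝ → ℝ} (hθ : IsTruncation C δ θ)
    {g : E → ℝ} (hg : DifferentiableAt ℝ g x) :
    ‖fderiv ℝ (fun y => θ (g y)) x‖ ≤ ‖fderiv ℝ g x‖ := by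
  refine (_root_.norm_fderiv_comp_le ((hθ.smooth 1).differentiable (by norm_num) _) hg).trans ?_
  rw [norm_fderiv_real]
  exact mul_le_of_le_one_left (norm_nonneg _) (hθ.abs_deriv_le _)

lemma IsTruncation.norm_fderiv_fderiv_comp_le {C δ : ℝ} {θ : ℝ → ℝ} (hθ : IsTruncation C δ θ)
    {g : E → ℝ} (hg : ContDiffAt ℝ 2 g x) :
    ‖fderiv ℝ (fderiv ℝ (fun y => θ (g y))) x‖ ≤
      |deriv (deriv θ) (g x)| * ‖fderiv ℝ g x‖ ^ 2 + ‖fderiv ℝ (fderiv ℝ g) x‖ := by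
  refine (_root_.norm_fderiv_fderiv_comp_le (hθ.smooth 2).contDiffAt hg).trans ?_
  rw [norm_fderiv_real, norm_fderiv_fderiv_real]
  gcongr
  exact mul_le_of_le_one_left (norm_nonneg _) (hθ.abs_deriv_le _)

end

lemma one_add_rpow_sq_le {s : ℝ} (hs : 0 ≤ s) (m : ℝ) :
    (1 + s ^ m) ^ 2 ≤ 2 * (1 + s ^ (m * 2)) := by
  have h : s ^ (m * 2) = (s ^ m) ^ 2 := by
    rw [Real.rpow_mul hs]
    exact_mod_cast rfl
  rw [h]
  nlinarith [sq_nonneg (1 - s ^ m)]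

variable {n : ℕ} {f g : (Fin n → ℝ) → ℝ}

/-- The growth condition of the test class in terms of iterated Fréchet derivatives. -/
lemma polyGrowth_iff {C m : ℝ} {x : Fin n → ℝ} : (∀ k : ℕ, k ≤ 2 →
      ‖iteratedFDeriv ℝ k f x‖ ≤ C * (1 + ‖x‖ ^ m)) ↔
    |f x| ≤ C * (1 + ‖x‖ ^ m) ∧ ‖fderiv ℝ f x‖ ≤ C * (1 + ‖x‖ ^ m) ∧
      ‖fderiv ℝ (fderiv ℝ f) x‖ ≤ C * (1 + ‖x‖ ^ m) := by
  have e2 : ‖iteratedFDeriv ℝ 2 f x‖ = ‖fderiv ℝ (fderiv ℝ f) x‖ := by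
    rw [← norm_iteratedFDeriv_one (fderiv ℝ f), norm_iteratedFDeriv_fderiv]
  constructor
  · intro h
    refine ⟨by simpa using h 0 (by norm_num), ?_, ?_⟩
    · rw [← norm_iteratedFDeriv_one f]; exact h 1 (by norm_num)
    · rw [← e2]; exact h 2 le_rfl
  · rintro ⟨h0, h1, h2⟩ k hk
    interval_cases k
    · simpa using h0
    · rwa [norm_iteratedFDeriv_one]
    · rwa [e2]

namespace MemTestClass

lemma contDiffAt (hf : MemTestClass n f) {x : Fin n → ℝ} (hx : x ∈ posOrth n) :
    ContDiffAt ℝ 4 f x :=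
  hf.smooth.contDiffAt ((isOpen_posOrth n).mem_nhds hx)

lemma add_of_bounded (hf : MemTestClass n f) (hg : ContDiffOn ℝ 5 g (posOrth n)) {C : ℝ}
    (hC : ∀ x ∈ posOrth n, |g x| ≤ C ∧ ‖fderiv ℝ g x‖ ≤ C ∧ ‖fderiv ℝ (fderiv ℝ g) x‖ ≤ C) :
    MemTestClass n fun y => f y + g y := by
  obtain ⟨α, hα, hα1, hhol⟩ := hf.holder4
  obtain ⟨A, m, hA⟩ := hf.polyGrowth
  have hU := isOpen_posOrth n
  have hH : HolderClass α (posOrth n) 4 fun y => f y + g y :=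
    (HolderClass.of_holderOnWith hf.smooth hhol).add hU
      (HolderClass.of_succ hα1 hU (by exact_mod_cast hg))
  refine ⟨hH.1, ⟨α, hα, hα1, hH.exists_holderOnWith hU⟩, A + |C|, m, fun x hx => ?_⟩
  have hfx : ContDiffAt ℝ 2 f x := (hf.contDiffAt hx).of_le (by norm_num)
  have hgx : ContDiffAt ℝ 2 g x := (hg.contDiffAt (hU.mem_nhds hx)).of_le (by norm_num)
  obtain ⟨h0, h1, h2⟩ := polyGrowth_iff.1 (hA x hx)
  obtain ⟨c0, c1, c2⟩ := hC x hx
  have hC' : C ≤ |C| * (1 + ‖x‖ ^ m) := by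
    have : 0 ≤ ‖x‖ ^ m := Real.rpow_nonneg (norm_nonneg _) _
    nlinarith [le_abs_self C, abs_nonneg C]
  rw [polyGrowth_iff, fderiv_fderiv_add hfx hgx,
    fderiv_fun_add (hfx.differentiableAt (by norm_num)) (hgx.differentiableAt (by norm_num)),
    add_mul]
  exact ⟨(abs_add_le _ _).trans (add_le_add h0 (c0.trans hC')),
    (norm_add_le _ _).trans (add_le_add h1 (c1.trans hC')),
    (norm_add_le _ _).trans (add_le_add h2 (c2.trans hC'))⟩

lemma flattened {C δ : ℝ} {θ : ℝ → ℝ} (hδ : 0 < δ) (hC : 0 ≤ C) (hθ : IsTruncation C δ θ)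
    (hf : MemTestClass n f) {x₀ : Fin n → ℝ}
    (hgap : ∀ x ∈ posOrth n, 0 ≤ tangentGap f x₀ x) :
    MemTestClass n (flattened θ f x₀) := by
  obtain ⟨α, hα, hα1, hhol⟩ := hf.holder4
  obtain ⟨A, m, hA⟩ := hf.polyGrowth
  have hU := isOpen_posOrth n
  have hfH : HolderClass α (posOrth n) 4 f := HolderClass.of_holderOnWith hf.smooth hhol
  have hgapH : HolderClass α (posOrth n) 4 (tangentGap f x₀) := by
    have haff : ContDiff ℝ (4 + 1 : ℕ) fun y => -f x₀ - fderiv ℝ f x₀ (y - x₀) := by fun_prop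
    refine (hfH.add hU (HolderClass.of_succ hα1 hU haff.contDiffOn)).congr hU fun y _ => ?_
    simp only [tangentGap]
    ring
  have hH : HolderClass α (posOrth n) 4 (_root_.flattened θ f x₀) := by
    refine (hfH.add hU (hgapH.comp_real (θ := fun s => -θ s) hα hα1 hU
      (fun m => (hθ.smooth m).neg))).congr hU fun y _ => ?_
    simp only [_root_.flattened, sub_eq_add_neg]
  refine ⟨hH.1, ⟨α, hα, hα1, hH.exists_holderOnWith hU⟩, ?_⟩
  set B := |A| + ‖fderiv ℝ f x₀‖ with hB
  set R := 2 * δ + (B + B) + (C / δ) * B ^ 2 with hR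
  have hB0 : 0 ≤ B := by positivity
  refine ⟨2 * R, m * 2, fun x hx => ?_⟩
  obtain ⟨h0, h1, h2⟩ := polyGrowth_iff.1 (hA x hx)
  have hfx : ContDiffAt ℝ 2 f x := (hf.contDiffAt hx).of_le (by norm_num)
  have hgx : ContDiffAt ℝ 2 (tangentGap f x₀) x := contDiffAt_tangentGap (k := 2) hfx
  have hθg : ContDiffAt ℝ 2 (fun y => θ (tangentGap f x₀ y)) x :=
    (hθ.smooth 2).contDiffAt.comp x hgx
  set N := 1 + ‖x‖ ^ m with hN
  have hN1 : 1 ≤ N := le_add_of_nonneg_right (Real.rpow_nonneg (norm_nonneg _) _)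
  have hN0 : 0 ≤ N := zero_le_one.trans hN1
  have hN2 : N ≤ N ^ 2 := by nlinarith
  have hAB : A * N + ‖fderiv ℝ f x₀‖ ≤ B * N := by
    nlinarith [le_abs_self A, norm_nonneg (fderiv ℝ f x₀)]
  have hAB' : A * N ≤ B * N := by linarith [norm_nonneg (fderiv ℝ f x₀)]
  have hbase : R * N ^ 2 ≤ 2 * R * (1 + ‖x‖ ^ (m * 2)) := by
    have := mul_le_mul_of_nonneg_left (one_add_rpow_sq_le (norm_nonneg x) m)
      (by positivity : 0 ≤ R)
    linarith
  have hg1 : ‖fderiv ℝ (tangentGap f x₀) x‖ ≤ B * N := by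
    rw [fderiv_tangentGap (hfx.differentiableAt (by norm_num))]
    exact (norm_sub_le _ _).trans (by linarith)
  have hRN : R * N ^ 2 = 2 * δ * N ^ 2 + (B * N ^ 2 + B * N ^ 2) + C / δ * (B * N) ^ 2 := by
    rw [hR]; ring
  have p1 : 0 ≤ C / δ * (B * N) ^ 2 := by positivity
  have p2 : 0 ≤ B * N ^ 2 := by positivity
  have p3 : B * N ≤ B * N ^ 2 := mul_le_mul_of_nonneg_left hN2 hB0
  have p4 : 2 * δ ≤ 2 * δ * N ^ 2 := by nlinarith
  have hd1 : fderiv ℝ (_root_.flattened θ f x₀) x =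
      fderiv ℝ f x - fderiv ℝ (fun y => θ (tangentGap f x₀ y)) x :=
    fderiv_fun_sub (hfx.differentiableAt (by norm_num)) (hθg.differentiableAt (by norm_num))
  have hd2 : fderiv ℝ (fderiv ℝ (_root_.flattened θ f x₀)) x =
      fderiv ℝ (fderiv ℝ f) x - fderiv ℝ (fderiv ℝ fun y => θ (tangentGap f x₀ y)) x :=
    fderiv_fderiv_sub hfx hθg
  rw [polyGrowth_iff, hd1, hd2]
  refine ⟨?_, ?_, ?_⟩
  · have := hθ.abs_le _ (hgap x hx)
    have := abs_sub (f x) (θ (tangentGap f x₀ x))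
    simp only [_root_.flattened]
    linarith
  · have := norm_sub_le (fderiv ℝ f x) (fderiv ℝ (fun y => θ (tangentGap f x₀ y)) x)
    have := hθ.norm_fderiv_comp_le (hgx.differentiableAt (by norm_num))
    linarith
  · have := norm_sub_le (fderiv ℝ (fderiv ℝ f) x)
      (fderiv ℝ (fderiv ℝ fun y => θ (tangentGap f x₀ y)) x)
    have q1 := hθ.norm_fderiv_fderiv_comp_le hgx
    rw [fderiv_fderiv_tangentGap hfx] at q1
    have q2 : |deriv (deriv θ) (tangentGap f x₀ x)| * ‖fderiv ℝ (tangentGap f x₀) x‖ ^ 2 ≤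
        C / δ * (B * N) ^ 2 := by
      gcongr
      exact hθ.abs_deriv_deriv_le _
    linarith

end MemTestClass

end Flattening

section Separation

set_option maxSynthPendingDepth 3

variable {n : ℕ}

/-- A strictly convex function which is bounded on the orthant together with its derivatives. -/
def expSum (y : Fin n → ℝ) : ℝ := ∑ i, Real.exp (-(y i))

lemma contDiff_expSum {m : WithTop ℕ∞} : ContDiff ℝ m (expSum (n := n)) := by
  unfold expSum
  fun_prop

lemma hasFDerivAt_exp_neg_apply (i : Fin n) (y : Fin n → ℝ) :
    HasFDerivAt (fun y : Fin n → ℝ => Real.exp (-(y i)))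
      (-Real.exp (-(y i)) • ContinuousLinearMap.proj (R := ℝ) (φ := fun _ : Fin n => ℝ) i) y := by
  have h := ((hasFDerivAt_apply (𝕜 := ℝ) i y).neg).exp
  rwa [smul_neg, ← neg_smul] at h

lemma fderiv_expSum (y : Fin n → ℝ) : fderiv ℝ expSum y =
    ∑ i, -Real.exp (-(y i)) • ContinuousLinearMap.proj (R := ℝ) (φ := fun _ : Fin n => ℝ) i :=
  HasFDerivAt.fderiv (HasFDerivAt.fun_sum fun i _ => hasFDerivAt_exp_neg_apply i y)

lemma convexOn_expSum : ConvexOn ℝ (posOrth n) expSum := by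
  refine ⟨convex_posOrth n, fun x _ y _ a b ha hb hab => ?_⟩
  simp only [expSum, smul_eq_mul, Finset.mul_sum, ← Finset.sum_add_distrib]
  refine Finset.sum_le_sum fun i _ => ?_
  have := convexOn_exp.2 (mem_univ (-(x i))) (mem_univ (-(y i))) ha hb hab
  simp only [smul_eq_mul, Pi.add_apply, Pi.smul_apply] at this ⊢
  convert this using 2
  ring

lemma expSum_bounds {y : Fin n → ℝ} (hy : y ∈ posOrth n) : |expSum y| ≤ n ∧
    ‖fderiv ℝ expSum y‖ ≤ n ∧ ‖fderiv ℝ (fderiv ℝ expSum) y‖ ≤ n := by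
  have hp : ∀ i : Fin n,
      ‖ContinuousLinearMap.proj (R := ℝ) (φ := fun _ : Fin n => ℝ) i‖ ≤ 1 := fun i =>
    ContinuousLinearMap.opNorm_le_bound _ zero_le_one fun x => by
      simpa using norm_le_pi_norm x i
  have he : ∀ i, Real.exp (-(y i)) ≤ 1 := fun i =>
    Real.exp_le_one_iff.2 (neg_nonpos.2 (hy i).le)
  have hsum : ∑ _i : Fin n, (1 : ℝ) = n := by simp
  rw [← hsum]
  refine ⟨?_, ?_, ?_⟩
  · refine (Finset.abs_sum_le_sum_abs _ _).trans (Finset.sum_le_sum fun i _ => ?_)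
    rw [Real.abs_exp]
    exact he i
  · rw [fderiv_expSum]
    refine norm_sum_le_of_le _ fun i _ => ?_
    rw [norm_smul, norm_neg, Real.norm_eq_abs, Real.abs_exp]
    exact mul_le_one₀ (he i) (norm_nonneg _) (hp i)
  · have h := fun i => (hasFDerivAt_exp_neg_apply i y).fun_neg.smul_const
      (ContinuousLinearMap.proj (R := ℝ) (φ := fun _ : Fin n => ℝ) i)
    have h' := (HasFDerivAt.fun_sum (u := Finset.univ) fun i _ => h i).fderiv
    rw [funext fderiv_expSum, h']
    refine norm_sum_le_of_le _ fun i _ => ?_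
    rw [ContinuousLinearMap.norm_smulRight_apply, norm_neg, norm_smul, norm_neg, Real.norm_eq_abs,
      Real.abs_exp]
    exact mul_le_one₀ (mul_le_one₀ (he i) (norm_nonneg _) (hp i)) (norm_nonneg _) (hp i)

lemma tangentGap_expSum_pos {x y : Fin n → ℝ} (h : y ≠ x) : 0 < tangentGap expSum x y := by
  have e : tangentGap expSum x y =
      ∑ i, Real.exp (-(x i)) * (Real.exp (-(y i - x i)) - (-(y i - x i) + 1)) := by
    simp only [tangentGap, fderiv_expSum, expSum, _root_.sum_apply, _root_.smul_apply,
      ContinuousLinearMap.proj_apply, smul_eq_mul, Pi.sub_apply, ← Finset.sum_sub_distrib]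
    refine Finset.sum_congr rfl fun i _ => ?_
    have : Real.exp (-(y i)) = Real.exp (-(x i)) * Real.exp (-(y i - x i)) := by
      rw [← Real.exp_add]; ring_nf
    rw [this]
    ring
  obtain ⟨i, hi⟩ := Function.ne_iff.1 h
  rw [e]
  refine Finset.sum_pos' (fun j _ => mul_nonneg (Real.exp_pos _).le
    (sub_nonneg.2 (Real.add_one_le_exp _))) ⟨i, Finset.mem_univ _, mul_pos (Real.exp_pos _)
    (sub_pos.2 (Real.add_one_lt_exp (neg_ne_zero.2 (sub_ne_zero.2 hi))))⟩

end Separation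

section Degenerate

variable {E : Type*} [NormedAddCommGroup E] [NormedSpace ℝ E] {f w : E → ℝ} {φ : E → E} {x v : E}

lemma ConvexOn.fderiv_fderiv_eq_zero {s : Set E} (hs : IsOpen s) (hf : ConvexOn ℝ s f)
    (hd : ContDiffOn ℝ 4 f s) (hx : x ∈ s) (hv : fderiv ℝ (fderiv ℝ f) x v v = 0) :
    fderiv ℝ (fderiv ℝ f) x v = 0 ∧ fderiv ℝ (fderiv ℝ (fderiv ℝ f)) x v v = 0 := by
  have hd2 : ContDiffOn ℝ 2 f s := hd.of_le (by norm_num)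
  have hfx : ContDiffAt ℝ 4 f x := hd.contDiffAt (hs.mem_nhds hx)
  have hpos : ∀ y ∈ s, ∀ a, 0 ≤ fderiv ℝ (fderiv ℝ f) y a a := fun y hy a =>
    hf.fderiv_fderiv_nonneg hs hd2 hy a
  have hD : DifferentiableAt ℝ (fderiv ℝ (fderiv ℝ f)) x :=
    ContDiffAt.differentiableAt_fderiv (hfx.fderiv_right (m := 2) (by norm_num))
  constructor
  · ext a
    refine apply_eq_zero_of_nonneg (fun a b => ?_) (hpos x hx) hv a
    exact (hfx.of_le (by norm_num) : ContDiffAt ℝ 2 f x).isSymmSndFDerivAt (by simp) a b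
  · have hmin : IsLocalMin (fun y => fderiv ℝ (fderiv ℝ f) y v v) x := by
      filter_upwards [hs.mem_nhds hx] with y hy
      rw [hv]
      exact hpos y hy v
    ext c
    have h0 := hmin.fderiv_eq_zero
    have h1 : fderiv ℝ (fun y => fderiv ℝ (fderiv ℝ f) y v v) x c =
        fderiv ℝ (fderiv ℝ (fderiv ℝ f)) x c v v := by
      have := ((hD.hasFDerivAt.clm_apply (hasFDerivAt_const v x)).clm_apply
        (hasFDerivAt_const v x)).fderiv
      rw [this]
      simp
    rw [fderiv_fderiv_fderiv_comm (hfx.of_le (by norm_num)), ← h1, h0]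

lemma fderiv_fderiv_jumpIncrement (hw : ContDiffAt ℝ 3 w x) (hw' : ContDiffAt ℝ 2 w (x + φ x))
    (hφ : ContDiffAt ℝ 2 φ x) (h2 : fderiv ℝ (fderiv ℝ w) x v = 0)
    (h3 : fderiv ℝ (fderiv ℝ (fderiv ℝ w)) x v v = 0) :
    fderiv ℝ (fderiv ℝ (jumpIncrement φ w)) x v v =
      fderiv ℝ (fderiv ℝ w) (x + φ x) (fderiv ℝ (fun y => y + φ y) x v)
          (fderiv ℝ (fun y => y + φ y) x v) +
        fderiv ℝ w (x + φ x) (fderiv ℝ (fderiv ℝ φ) x v v) -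
        fderiv ℝ w x (fderiv ℝ (fderiv ℝ φ) x v v) := by
  have hc := contDiffAt_comp_id_add hw' hφ
  have hl := contDiffAt_apply_fderiv hw hφ
  have e1 : fderiv ℝ (fderiv ℝ (jumpIncrement φ w)) x =
      fderiv ℝ (fderiv ℝ fun y => w (y + φ y)) x - fderiv ℝ (fderiv ℝ w) x -
        fderiv ℝ (fderiv ℝ fun y => fderiv ℝ w y (φ y)) x := by
    have hw2 : ContDiffAt ℝ 2 w x := hw.of_le (by norm_num)
    rw [← fderiv_fderiv_sub hc hw2, ← fderiv_fderiv_sub (hc.sub hw2) hl]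
    rfl
  rw [e1]
  simp only [_root_.sub_apply]
  rw [fderiv_fderiv_comp (Φ := fun y => y + φ y) hw' (contDiffAt_id.add hφ), fderiv_fderiv_id_add hφ,
    fderiv_fderiv_clm_apply (hw.fderiv_right (m := 2) (by norm_num)) hφ, h2, h3]
  simp

end Degenerate

section Approximation

set_option maxSynthPendingDepth 3

variable {n : ℕ} {f : (Fin n → ℝ) → ℝ} {x₀ : Fin n → ℝ}

set_option maxHeartbeats 1000000 in
/-- A convex test function has convex test functions `h η` which are affine near `x₀` and such that
the first two derivatives of `f - h η` tend to zero boundedly away from `x₀`. -/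
lemma exists_flattening (hf : MemTestClass n f) (hconv : ConvexOn ℝ (posOrth n) f)
    (hx₀ : x₀ ∈ posOrth n) : ∃ h : ℝ → (Fin n → ℝ) → ℝ,
      (∀ η, 0 < η → MemTestClass n (h η) ∧ ConvexOn ℝ (posOrth n) (h η) ∧
        ∃ (c : ℝ) (L : (Fin n → ℝ) →L[ℝ] ℝ), h η =ᶠ[𝓝 x₀] fun y => c + L (y - x₀)) ∧
      (∀ a ∈ posOrth n, ∀ b, ∃ N, ∀ η ∈ Ioc (0 : ℝ) 1, ∀ p ∈ Icc a b,
        ‖fderiv ℝ (fun y => f y - h η y) p‖ ≤ N ∧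
          ‖fderiv ℝ (fderiv ℝ fun y => f y - h η y) p‖ ≤ N) ∧
      (∀ p ∈ posOrth n, p ≠ x₀ →
        Tendsto (fun η => fderiv ℝ (fun y => f y - h η y) p) (𝓝[>] 0) (𝓝 0) ∧
          Tendsto (fun η => fderiv ℝ (fderiv ℝ fun y => f y - h η y) p) (𝓝[>] 0) (𝓝 0)) ∧
      Tendsto (fun η => fderiv ℝ (fun y => f y - h η y) x₀) (𝓝[>] 0) (𝓝 0) := by
  obtain ⟨C, hC0, hC⟩ := exists_isTruncation
  choose! θ hθ using hC
  have hU := isOpen_posOrth n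
  have hfd : ∀ y ∈ posOrth n, ContDiffAt ℝ 2 f y := fun y hy =>
    (hf.contDiffAt hy).of_le (by norm_num)
  have hPd : ∀ y, ContDiffAt ℝ 2 (expSum (n := n)) y := fun y => contDiff_expSum.contDiffAt
  set F : ℝ → (Fin n → ℝ) → ℝ := fun η y => f y + η * expSum y with hF
  set G : ℝ → (Fin n → ℝ) → ℝ := fun η => tangentGap (F η) x₀ with hG
  have hGeq : ∀ η, G η = fun y => tangentGap f x₀ y + η * tangentGap expSum x₀ y := fun η =>
    funext fun y => tangentGap_add_const_mul η ((hfd x₀ hx₀).differentiableAt (by norm_num))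
      ((hPd x₀).differentiableAt (by norm_num)) y
  have hgf : ∀ y ∈ posOrth n, 0 ≤ tangentGap f x₀ y := fun y hy =>
    hconv.tangentGap_nonneg hx₀ hy ((hfd x₀ hx₀).differentiableAt (by norm_num))
  have hgP : ∀ y ∈ posOrth n, 0 ≤ tangentGap expSum x₀ y := fun y hy =>
    convexOn_expSum.tangentGap_nonneg hx₀ hy ((hPd x₀).differentiableAt (by norm_num))
  have hFd : ∀ η, ∀ y ∈ posOrth n, ContDiffAt ℝ 2 (F η) y := fun η y hy =>
    (hfd y hy).add (contDiffAt_const.mul (hPd y))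
  have hgfd : ∀ y ∈ posOrth n, ContDiffAt ℝ 2 (tangentGap f x₀) y := fun y hy =>
    contDiffAt_tangentGap (k := 2) (hfd y hy)
  have hgPd : ∀ y, ContDiffAt ℝ 2 (tangentGap (expSum (n := n)) x₀) y := fun y =>
    contDiffAt_tangentGap (k := 2) (hPd y)
  have hGd : ∀ η, ∀ y ∈ posOrth n, ContDiffAt ℝ 2 (G η) y := fun η y hy =>
    contDiffAt_tangentGap (k := 2) (hFd η y hy)
  set h : ℝ → (Fin n → ℝ) → ℝ := fun η => flattened (θ (η ^ 2)) (F η) x₀ with hh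
  have hw : ∀ η, (fun y => f y - h η y) = fun y => θ (η ^ 2) (G η y) - η * expSum y := fun η => by
    funext y
    simp only [hh, flattened, hF, hG]
    ring
  have hD : ∀ η, 0 < η → ∀ y ∈ posOrth n,
      fderiv ℝ (fun y => f y - h η y) y =
        fderiv ℝ (fun y => θ (η ^ 2) (G η y)) y - η • fderiv ℝ expSum y ∧
      fderiv ℝ (fderiv ℝ fun y => f y - h η y) y =
        fderiv ℝ (fderiv ℝ fun y => θ (η ^ 2) (G η y)) y - η • fderiv ℝ (fderiv ℝ expSum) y := by
    intro η hη y hy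
    have h1 : ContDiffAt ℝ 2 (fun y => θ (η ^ 2) (G η y)) y :=
      ((hθ _ (by positivity)).smooth 2).contDiffAt.comp y (hGd η y hy)
    have h2 : ContDiffAt ℝ 2 (fun y => η * expSum y) y := contDiffAt_const.mul (hPd y)
    rw [hw, fderiv_fderiv_sub h1 h2, fderiv_fun_sub (h1.differentiableAt (by norm_num))
      (h2.differentiableAt (by norm_num)), (fderiv_fderiv_const_mul η y).1,
      (fderiv_fderiv_const_mul η y).2]
    exact ⟨rfl, rfl⟩
  have hcvx : ∀ η, 0 < η → ConvexOn ℝ (posOrth n) (F η) := fun η hη =>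
    hconv.add (convexOn_expSum.smul hη.le)
  have hsmall : ∀ {X : Type} [NormedAddCommGroup X] [NormedSpace ℝ X] (a : X),
      Tendsto (fun η : ℝ => -(η • a)) (𝓝[>] 0) (𝓝 0) := by
    intro X _ _ a
    have : Tendsto (fun η : ℝ => -(η • a)) (𝓝 0) (𝓝 (-((0 : ℝ) • a))) :=
      (by fun_prop : Continuous fun η : ℝ => -(η • a)).tendsto 0
    rw [zero_smul, neg_zero] at this
    exact this.mono_left nhdsWithin_le_nhds
  refine ⟨h, fun η hη => ⟨?_, convexOn_flattened (hθ _ (by positivity)) (hcvx η hη), ?_⟩,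
    fun a ha b => ?_, fun p hp hpx => ?_, ?_⟩
  · have hFm : MemTestClass n (F η) := by
      refine hf.add_of_bounded (g := fun y => η * expSum y) (C := η * n)
        (contDiff_const.mul contDiff_expSum).contDiffOn fun x hx => ?_
      obtain ⟨b0, b1, b2⟩ := expSum_bounds hx
      rw [(fderiv_fderiv_const_mul η x).1, (fderiv_fderiv_const_mul η x).2, norm_smul, norm_smul,
        abs_mul, Real.norm_eq_abs, abs_of_pos hη]
      refine ⟨?_, ?_, ?_⟩ <;> gcongr
    exact hFm.flattened (by positivity) hC0 (hθ _ (by positivity)) fun x hx =>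
      (hcvx η hη).tangentGap_nonneg hx₀ hx ((hFd η x₀ hx₀).differentiableAt (by norm_num))
  · exact ⟨_, _, flattened_eventuallyEq (by positivity) (hθ (η ^ 2) (by positivity))
      (hFd η x₀ hx₀)⟩
  · have hK : IsCompact (Icc a b) := isCompact_Icc
    have hKU := Icc_subset_posOrth (b := b) ha
    obtain ⟨A, hA0, hA⟩ := exists_norm_fderiv_sq_le hU hK hKU
      (fun y hy => (hgfd y hy).contDiffWithinAt) hgf
    obtain ⟨A', hA0', hA'⟩ := exists_norm_fderiv_sq_le hU hK hKU
      (fun y _ => (hgPd y).contDiffWithinAt) hgP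
    have hc1 : ContinuousOn (fderiv ℝ (tangentGap f x₀)) (Icc a b) := fun y hy =>
      (hgfd y (hKU hy)).differentiableAt_fderiv.continuousAt.continuousWithinAt
    have hc2 : ContinuousOn (fderiv ℝ (fderiv ℝ f)) (Icc a b) := fun y hy =>
      (((hfd y (hKU hy)).fderiv_right (m := 1) (by norm_num)).fderiv_right (m := 0)
        (by norm_num)).continuousAt.continuousWithinAt
    obtain ⟨N₁, hN₁⟩ := hK.exists_bound_of_continuousOn hc1
    obtain ⟨N₂, hN₂⟩ := hK.exists_bound_of_continuousOn hc2
    refine ⟨max (N₁ + (n + n) + n) (2 * (A + A') * C + (N₂ + n) + n), fun η hη p hp => ?_⟩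
    have hpU := hKU hp
    have hη1 := hη.2
    have hη0 := hη.1
    obtain ⟨-, b1, b2⟩ := expSum_bounds hpU
    obtain ⟨-, b1', -⟩ := expSum_bounds hx₀
    have e1 : fderiv ℝ (G η) p =
        fderiv ℝ (tangentGap f x₀) p + η • fderiv ℝ (tangentGap expSum x₀) p := by
      rw [hGeq, fderiv_fun_add ((hgfd p hpU).differentiableAt (by norm_num))
        (((hgPd p).differentiableAt (by norm_num)).const_mul η), (fderiv_fderiv_const_mul η p).1]
    have e2 : fderiv ℝ (fderiv ℝ (G η)) p =
        fderiv ℝ (fderiv ℝ f) p + η • fderiv ℝ (fderiv ℝ expSum) p := by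
      rw [fderiv_fderiv_tangentGap (hFd η p hpU), fderiv_fderiv_add (hfd p hpU)
        (contDiffAt_const.mul (hPd p)), (fderiv_fderiv_const_mul η p).2]
    have hsm : ∀ {X : Type} [NormedAddCommGroup X] [NormedSpace ℝ X] (a : X), ‖η • a‖ ≤ ‖a‖ := by
      intro X _ _ a
      rw [norm_smul, Real.norm_eq_abs, abs_of_pos hη0]
      exact mul_le_of_le_one_left (norm_nonneg _) hη1
    have hP1 : ‖fderiv ℝ (tangentGap expSum x₀) p‖ ≤ n + n := by
      rw [fderiv_tangentGap ((hPd p).differentiableAt (by norm_num))]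
      exact (norm_sub_le _ _).trans (add_le_add b1 b1')
    have hG1 : ‖fderiv ℝ (G η) p‖ ≤ N₁ + (n + n) := by
      rw [e1]
      exact (norm_add_le _ _).trans (add_le_add (hN₁ p hp) ((hsm _).trans hP1))
    have hG2 : ‖fderiv ℝ (fderiv ℝ (G η)) p‖ ≤ N₂ + n := by
      rw [e2]
      exact (norm_add_le _ _).trans (add_le_add (hN₂ p hp) ((hsm _).trans b2))
    have hGv : G η p = tangentGap f x₀ p + η * tangentGap expSum x₀ p := congrFun (hGeq η) p
    have hf0 := hgf p hpU
    have hP0 := hgP p hpU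
    have hG0 : 0 ≤ G η p := by rw [hGv]; positivity
    have hGsq : ‖fderiv ℝ (G η) p‖ ^ 2 ≤ 2 * (A + A') * G η p := by
      have q1 : ‖fderiv ℝ (G η) p‖ ≤ ‖fderiv ℝ (tangentGap f x₀) p‖ +
          η * ‖fderiv ℝ (tangentGap expSum x₀) p‖ := by
        rw [e1]
        refine (norm_add_le _ _).trans_eq ?_
        rw [norm_smul, Real.norm_eq_abs, abs_of_pos hη0]
      have q2 := hA p hp
      have q3 := hA' p hp
      set u := ‖fderiv ℝ (tangentGap f x₀) p‖
      set u' := ‖fderiv ℝ (tangentGap expSum x₀) p‖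
      set s := tangentGap f x₀ p
      set s' := tangentGap expSum x₀ p
      calc ‖fderiv ℝ (G η) p‖ ^ 2 ≤ (u + η * u') ^ 2 := by gcongr
        _ ≤ 2 * u ^ 2 + 2 * (η * η) * u' ^ 2 := by nlinarith [sq_nonneg (u - η * u')]
        _ ≤ 2 * (A * s) + 2 * (1 * η) * (A' * s') := by gcongr
        _ ≤ 2 * (A + A') * G η p := by
          rw [hGv]
          have r1 : 0 ≤ A' * s := by positivity
          have r2 : 0 ≤ A * (η * s') := by positivity
          linarith
    have hθη := hθ (η ^ 2) (by positivity)
    obtain ⟨d1, d2⟩ := hD η hη0 p hpU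
    rw [d1, d2]
    constructor
    · refine le_max_of_le_left ((norm_sub_le _ _).trans (add_le_add ?_ ((hsm _).trans b1)))
      exact (hθη.norm_fderiv_comp_le ((hGd η p hpU).differentiableAt (by norm_num))).trans hG1
    · refine le_max_of_le_right ((norm_sub_le _ _).trans (add_le_add ?_ ((hsm _).trans b2)))
      refine (hθη.norm_fderiv_fderiv_comp_le (hGd η p hpU)).trans (add_le_add ?_ hG2)
      have r := hθη.abs_deriv_deriv_mul_le _ hG0
      calc _ ≤ |deriv (deriv (θ (η ^ 2))) (G η p)| * (2 * (A + A') * G η p) := by gcongr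
        _ = 2 * (A + A') * (|deriv (deriv (θ (η ^ 2))) (G η p)| * G η p) := by ring
        _ ≤ _ := by gcongr
  · have hq : 0 < tangentGap expSum x₀ p := tangentGap_expSum_pos hpx
    have hev : ∀ᶠ η : ℝ in 𝓝[>] 0, -(η • fderiv ℝ expSum p) = fderiv ℝ (fun y => f y - h η y) p ∧
        -(η • fderiv ℝ (fderiv ℝ expSum) p) = fderiv ℝ (fderiv ℝ fun y => f y - h η y) p := by
      filter_upwards [Ioo_mem_nhdsGT (half_pos hq)] with η hη
      have hη0 := hη.1
      have hlt : 2 * η ^ 2 < G η p := by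
        have := hgf p hp
        have h2 := hη.2
        rw [hGeq]
        simp only
        nlinarith
      have hc : (fun y => θ (η ^ 2) (G η y)) =ᶠ[𝓝 p] fun _ => θ (η ^ 2) (2 * η ^ 2) := by
        filter_upwards [(hGd η p hp).continuousAt.eventually (lt_mem_nhds hlt)] with y hy
        exact (hθ (η ^ 2) (by positivity)).eq_const _ hy.le
      have hc1 : fderiv ℝ (fun y => θ (η ^ 2) (G η y)) =ᶠ[𝓝 p] fun _ => 0 := by
        filter_upwards [hc.eventuallyEq_nhds] with y hy
        rw [hy.fderiv_eq, fderiv_const_apply]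
      obtain ⟨d1, d2⟩ := hD η hη0 p hp
      rw [d1, d2, hc1.eq_of_nhds, hc1.fderiv_eq, fderiv_const_apply]
      exact ⟨(zero_sub _).symm, (zero_sub _).symm⟩
    exact ⟨(hsmall _).congr' (hev.mono fun _ h => h.1), (hsmall _).congr' (hev.mono fun _ h => h.2)⟩
  · refine (hsmall (fderiv ℝ expSum x₀)).congr' ?_
    filter_upwards [self_mem_nhdsWithin] with η hη
    have hη0 : 0 < η := hη
    have hz : fderiv ℝ (fun y => θ (η ^ 2) (G η y)) x₀ = 0 := by
      have hc : (fun y => θ (η ^ 2) (G η y)) =ᶠ[𝓝 x₀] G η := by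
        have hlt : G η x₀ < η ^ 2 := by
          rw [hG]
          simp only [tangentGap_self]
          positivity
        filter_upwards [(hGd η x₀ hx₀).continuousAt.eventually (gt_mem_nhds hlt)] with y hy
        exact (hθ (η ^ 2) (by positivity)).eq_self _ hy.le
      rw [hc.fderiv_eq, fderiv_tangentGap ((hFd η x₀ hx₀).differentiableAt (by norm_num)), sub_self]
    rw [(hD η hη0 x₀ hx₀).1, hz, zero_sub]

end Approximation

section Conclusion

set_option maxSynthPendingDepth 3

variable {n : ℕ} {T : ℝ} {f h : (Fin n → ℝ) → ℝ} {x₀ v : Fin n → ℝ} {t : ℝ}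

lemma tendsto_clm_apply_zero {ι E G : Type*} [NormedAddCommGroup E] [NormedSpace ℝ E]
    [NormedAddCommGroup G] [NormedSpace ℝ G] {l : Filter ι} {F : ι → E →L[ℝ] G} (u : E)
    (hF : Tendsto F l (𝓝 0)) : Tendsto (fun i => F i u) l (𝓝 0) := by
  have := ((ContinuousLinearMap.apply ℝ G u).continuous.tendsto 0).comp hF
  rwa [map_zero] at this

lemma eventually_dmix_eq_zero {c : ℝ} {L : (Fin n → ℝ) →L[ℝ] ℝ}
    (hh : h =ᶠ[𝓝 x₀] fun y => c + L (y - x₀)) : ∀ᶠ y in 𝓝 x₀, ∀ a b, dmix h y a b = 0 := by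
  have e : fderiv ℝ h =ᶠ[𝓝 x₀] fun _ => L := by
    filter_upwards [hh.eventuallyEq_nhds] with y hy
    rw [hy.fderiv_eq]
    exact ((L.hasFDerivAt.comp y ((hasFDerivAt_id y).sub_const x₀)).const_add c).fderiv
  filter_upwards [e.eventuallyEq_nhds] with y hy a b
  have : (fun u => fderiv ℝ h u a) =ᶠ[𝓝 y] fun _ => L a := hy.mono fun u hu => by simp only [hu]
  rw [dmix, this.fderiv_eq, fderiv_const_apply]
  rfl

lemma Aop_eq_zero {Dk : DiffKernel n T} {x : Fin n → ℝ} (hh : ∀ a b, dmix h x a b = 0) :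
    Aop Dk h x t = 0 := by
  simp [Aop, hh]

lemma fderiv_fderiv_sub_eventuallyEq {c : ℝ} {L : (Fin n → ℝ) →L[ℝ] ℝ}
    (hf : ContDiffAt ℝ 2 f x₀) (hh : h =ᶠ[𝓝 x₀] fun y => c + L (y - x₀)) :
    fderiv ℝ (fderiv ℝ fun y => f y - h y) =ᶠ[𝓝 x₀] fderiv ℝ (fderiv ℝ f) := by
  have e : fderiv ℝ (fun y => f y - h y) =ᶠ[𝓝 x₀] fun y => fderiv ℝ f y - L := by
    filter_upwards [hh.eventuallyEq_nhds, hf.eventually_contDiffAt_two] with y hy hfy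
    have hL := (L.hasFDerivAt.comp y ((hasFDerivAt_id y).sub_const x₀)).const_add c
    exact ((hfy.differentiableAt (by norm_num)).hasFDerivAt.sub
      (hL.congr_of_eventuallyEq hy)).fderiv
  filter_upwards [e.eventuallyEq_nhds] with y hy
  rw [hy.fderiv_eq, fderiv_sub_const]

/-- A convex test function with vanishing second derivative in some direction is approximated,
as far as the jump operator is concerned, by convex test functions which are affine nearby. -/
lemma exists_locally_affine_approx (K : JumpKernel n T) (hK : K.AENonzero) (lam : ℝ → ℝ)
    (ht : t ∈ Icc 0 T) (hf : MemTestClass n f) (hconv : ConvexOn ℝ (posOrth n) f)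
    (hx₀ : x₀ ∈ posOrth n) (hvv : dir2 f x₀ v = 0) {ε : ℝ} (hε : 0 < ε) :
    ∃ h : (Fin n → ℝ) → ℝ, MemTestClass n h ∧ ConvexOn ℝ (posOrth n) h ∧
      (∀ᶠ y in 𝓝 x₀, ∀ a b, dmix h y a b = 0) ∧
      |dir2 (fun y => Bop lam K (fun u => f u - h u) y t) x₀ v| ≤ ε := by
  obtain ⟨h, hmem, hbdd, hlim, hlim₀⟩ := exists_flattening hf hconv hx₀
  have hU := isOpen_posOrth n
  obtain ⟨a, ha, b, hab⟩ := K.exists_box ht hx₀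
  obtain ⟨C, hC0, hC⟩ := K.exists_local_bounds ht hx₀
  obtain ⟨hx₀K, hpK⟩ := hab.self_of_nhds
  obtain ⟨N, hN⟩ := hbdd a ha b
  have hC := hC.self_of_nhds
  set w : ℝ → (Fin n → ℝ) → ℝ := fun η y => f y - h η y with hw
  have hfx : ContDiffAt ℝ 2 f x₀ := (hf.contDiffAt hx₀).of_le (by norm_num)
  rw [dir2_eq_fderiv_fderiv hfx.differentiableAt_fderiv] at hvv
  obtain ⟨hf2, hf3⟩ := hconv.fderiv_fderiv_eq_zero hU hf.smooth hx₀ hvv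
  have hwd : ∀ η, 0 < η → ContDiffOn ℝ 4 (w η) (posOrth n) := fun η hη =>
    hf.smooth.sub (hmem η hη).1.smooth
  set J : ℝ → ℝ → ℝ := fun η z => dir2 (jumpIncrement (fun y => K.φ y t z) (w η)) x₀ v with hJ
  have hJeq : ∀ η, 0 < η → ∀ z ∈ Icc (0 : ℝ) 1, J η z =
      fderiv ℝ (fderiv ℝ (w η)) (x₀ + K.φ x₀ t z) (fderiv ℝ (fun y => y + K.φ y t z) x₀ v)
          (fderiv ℝ (fun y => y + K.φ y t z) x₀ v) +
        fderiv ℝ (w η) (x₀ + K.φ x₀ t z) (fderiv ℝ (fderiv ℝ fun y => K.φ y t z) x₀ v v) -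
        fderiv ℝ (w η) x₀ (fderiv ℝ (fderiv ℝ fun y => K.φ y t z) x₀ v v) := by
    intro η hη z hz
    obtain ⟨-, -, c, L, hL⟩ := hmem η hη
    have e := fderiv_fderiv_sub_eventuallyEq hfx hL
    have h3 : ContDiffAt ℝ 3 (w η) x₀ :=
      ((hwd η hη).contDiffAt (hU.mem_nhds hx₀)).of_le (by norm_num)
    have h2 : ContDiffAt ℝ 2 (w η) (x₀ + K.φ x₀ t z) :=
      ((hwd η hη).contDiffAt (hU.mem_nhds (K.add_mem_posOrth ht hz hx₀))).of_le (by norm_num)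
    have hφ := K.contDiffAt ht hz hx₀
    rw [hJ]
    simp only
    rw [dir2_eq_fderiv_fderiv (contDiffAt_jumpIncrement h3 h2 hφ).differentiableAt_fderiv]
    exact fderiv_fderiv_jumpIncrement h3 h2 hφ (by rw [e.eq_of_nhds, hf2])
      (by rw [e.fderiv_eq, hf3])
  have hint : ∀ η, 0 < η → IntegrableOn (J η) (Icc (0 : ℝ) 1) := fun η hη =>
    (K.dir2_Bop ht hx₀ (hwd η hη) lam v).1
  have htend : Tendsto (fun η => ∫ z in Icc (0 : ℝ) 1, J η z) (𝓝[>] 0)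
      (𝓝 (∫ _ in Icc (0 : ℝ) 1, (0 : ℝ))) := by
    refine tendsto_integral_filter_of_dominated_convergence
      (fun _ => N * ((1 + C) * ‖v‖) ^ 2 + N * (C * ‖v‖ ^ 2) + N * (C * ‖v‖ ^ 2)) ?_ ?_
      (integrableOn_const (by simp)) ?_
    · filter_upwards [self_mem_nhdsWithin] with η hη
      exact (hint η hη).aestronglyMeasurable
    · filter_upwards [Ioc_mem_nhdsGT zero_lt_one] with η hη
      filter_upwards [ae_restrict_mem measurableSet_Icc] with z hz
      obtain ⟨-, c1, c2⟩ := hC z hz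
      obtain ⟨m1, m2⟩ := hN η hη _ (hpK z hz)
      obtain ⟨m0, -⟩ := hN η hη _ hx₀K
      have hN0 : 0 ≤ N := (norm_nonneg _).trans m0
      have d1 : ‖fderiv ℝ (fun y => y + K.φ y t z) x₀ v‖ ≤ (1 + C) * ‖v‖ :=
        ContinuousLinearMap.le_of_opNorm_le _ (norm_fderiv_id_add_le
          ((K.contDiffAt ht hz hx₀).differentiableAt (by norm_num)) c1) v
      have d2 : ‖fderiv ℝ (fderiv ℝ fun y => K.φ y t z) x₀ v v‖ ≤ C * ‖v‖ ^ 2 := by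
        rw [pow_two, ← mul_assoc]
        exact ContinuousLinearMap.le_of_opNorm_le _
          (ContinuousLinearMap.le_of_opNorm_le _ c2 v) v
      rw [hJeq η hη.1 z hz]
      refine (norm_sub_le _ _).trans (add_le_add ((norm_add_le _ _).trans (add_le_add ?_ ?_)) ?_)
      · rw [pow_two, ← mul_assoc]
        exact ContinuousLinearMap.le_of_opNorm_le_of_le _
          (ContinuousLinearMap.le_of_opNorm_le_of_le _ m2 d1) d1
      · exact ContinuousLinearMap.le_of_opNorm_le_of_le _ m1 d2
      · exact ContinuousLinearMap.le_of_opNorm_le_of_le _ m0 d2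
    · filter_upwards [hK x₀ hx₀ t ht, ae_restrict_mem measurableSet_Icc] with z hz0 hz
      obtain ⟨l1, l2⟩ := hlim (x₀ + K.φ x₀ t z) (K.add_mem_posOrth ht hz hx₀)
        (fun e => hz0 (by simpa using e))
      set u := fderiv ℝ (fun y => y + K.φ y t z) x₀ v
      set q := fderiv ℝ (fderiv ℝ fun y => K.φ y t z) x₀ v v
      have l3 : Tendsto (fun η => fderiv ℝ (fderiv ℝ (w η)) (x₀ + K.φ x₀ t z) u u)
          (𝓝[>] 0) (𝓝 0) := by
        exact tendsto_clm_apply_zero u (tendsto_clm_apply_zero u l2)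
      have key := (l3.add (tendsto_clm_apply_zero q l1)).sub (tendsto_clm_apply_zero q hlim₀)
      rw [add_zero, sub_zero] at key
      refine key.congr' ?_
      filter_upwards [self_mem_nhdsWithin] with η hη
      exact (hJeq η hη z hz).symm
  have hB : Tendsto (fun η => |dir2 (fun y => Bop lam K (w η) y t) x₀ v|) (𝓝[>] 0) (𝓝 0) := by
    have := (htend.const_mul (lam t)).abs
    rw [integral_zero, mul_zero, abs_zero] at this
    refine this.congr' ?_
    filter_upwards [self_mem_nhdsWithin] with η hη
    rw [(K.dir2_Bop ht hx₀ (hwd η hη) lam v).2]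
  obtain ⟨η, hη, hη0⟩ := ((hB.eventually (gt_mem_nhds hε)).and self_mem_nhdsWithin).exists
  obtain ⟨g1, g2, c, L, hL⟩ := hmem η hη0
  exact ⟨h η, g1, g2, eventually_dmix_eq_zero hL, hη.le⟩

lemma dir2_Bop_sub (K : JumpKernel n T) (lam : ℝ → ℝ) (ht : t ∈ Icc 0 T) (hx₀ : x₀ ∈ posOrth n)
    (hf : ContDiffOn ℝ 4 f (posOrth n)) (hh : ContDiffOn ℝ 4 h (posOrth n)) (v : Fin n → ℝ) :
    dir2 (fun y => Bop lam K (fun u => f u - h u) y t) x₀ v =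
      dir2 (fun y => Bop lam K f y t) x₀ v - dir2 (fun y => Bop lam K h y t) x₀ v := by
  have hU := isOpen_posOrth n
  have hd : ∀ {g : (Fin n → ℝ) → ℝ}, ContDiffOn ℝ 4 g (posOrth n) → ∀ y ∈ posOrth n,
      ContDiffAt ℝ 3 g y := fun hg y hy => (hg.contDiffAt (hU.mem_nhds hy)).of_le (by norm_num)
  obtain ⟨i1, e1⟩ := K.dir2_Bop ht hx₀ hf lam v
  obtain ⟨i2, e2⟩ := K.dir2_Bop ht hx₀ hh lam v
  rw [(K.dir2_Bop ht hx₀ (hf.sub hh) lam v).2, e1, e2, ← mul_sub, ← integral_sub i1 i2]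
  congr 1
  refine setIntegral_congr_fun measurableSet_Icc fun z hz => ?_
  have hp := K.add_mem_posOrth ht hz hx₀
  have hφ := K.contDiffAt ht hz hx₀
  rw [← dir2_sub
    (contDiffAt_jumpIncrement (hd hf _ hx₀) ((hd hf _ hp).of_le (by norm_num)) hφ)
    (contDiffAt_jumpIncrement (hd hh _ hx₀) ((hd hh _ hp).of_le (by norm_num)) hφ)]
  refine dir2_congr ?_ v
  filter_upwards [hU.mem_nhds hx₀] with y hy
  simp only [jumpIncrement]
  rw [fderiv_fun_sub ((hd hf y hy).differentiableAt (by norm_num))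
    ((hd hh y hy).differentiableAt (by norm_num)), _root_.sub_apply]
  ring

end Conclusion

end

/-- Lemma 4.4: given `t₀ ∈ [0,T]` and a convex `f ∈ F` with `∂_v²f(x₀) = 0` at some
`x₀ ∈ (0,∞)ⁿ` and direction `v ≠ 0`, for any `ε > 0` there is a convex `h ∈ F` with
`∂_v²h(x₀) = 0`, `∂_v²(Ah)(x₀,t₀) = 0` and `|∂_v²(B(f−h))(x₀,t₀)| ≤ ε`. Consequently,
if `M = A + B` is LCP at all points, then `B` is LCP at all points. -/
theorem lcp_B_of_lcp_M {n : ℕ} {T : ℝ} (hT : 0 < T)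
    (K : JumpKernel n T) (hK : K.AENonzero)
    (Dk : DiffKernel n T)
    (lam : ℝ → ℝ) (hlam : LamOK T lam)
    (t₀ : ℝ) (ht₀ : t₀ ∈ Set.Icc (0:ℝ) T)
    (f : (Fin n → ℝ) → ℝ) (hf : MemTestClass n f) (hconv : ConvexOn ℝ (posOrth n) f)
    (x₀ : Fin n → ℝ) (hx₀ : x₀ ∈ posOrth n)
    (v : Fin n → ℝ) (hv : v ≠ 0) (hvv : dir2 f x₀ v = 0)
    (ε : ℝ) (hε : 0 < ε) :
    (∃ h : (Fin n → ℝ) → ℝ, MemTestClass n h ∧ ConvexOn ℝ (posOrth n) h ∧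
      dir2 h x₀ v = 0 ∧
      dir2 (fun y => Aop Dk h y t₀) x₀ v = 0 ∧
      |dir2 (fun y => Bop lam K (fun u => f u - h u) y t₀) x₀ v| ≤ ε) ∧
    ((∀ x ∈ posOrth n, ∀ t ∈ Set.Icc (0:ℝ) T,
        IsLCPAt (fun g y s => Aop Dk g y s + Bop lam K g y s) x t) →
      ∀ x ∈ posOrth n, ∀ t ∈ Set.Icc (0:ℝ) T, IsLCPAt (Bop lam K) x t) := by
  constructor
  · obtain ⟨h, h1, h2, h3, h4⟩ := exists_locally_affine_approx K hK lam ht₀ hf hconv hx₀ hvv hε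
    refine ⟨h, h1, h2, h3.self_of_nhds v v, ?_, h4⟩
    rw [dir2_congr (h3.mono fun y hy => Aop_eq_zero hy : (fun y => Aop Dk h y t₀) =ᶠ[_]
      fun _ => (0 : ℝ))]
    simp [dir2, dmix]
  · intro hM x hx t ht u hu g hg hgc hgu
    refine le_of_forall_pos_le_add fun δ hδ => ?_
    obtain ⟨h, h1, h2, h3, h4⟩ := exists_locally_affine_approx K hK lam ht hg hgc hx hgu hδ
    have h5 := hM x hx t ht u hu h h1 h2 (h3.self_of_nhds u u)
    rw [dir2_congr (h3.mono fun y hy => by simp only [Aop_eq_zero hy, zero_add] :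
      (fun y => Aop Dk h y t + Bop lam K h y t) =ᶠ[_] fun y => Bop lam K h y t)] at h5
    rw [dir2_Bop_sub K lam ht hx hg.smooth h1.smooth] at h4
    have := (abs_le.1 h4).1
    show 0 ≤ dir2 (fun y => Bop lam K g y t) x u + δ
    linarith

end
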